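/- arXiv:1302.1222 — 6 statements merged into one kernel-verified Lean document; each statement's English description precedes it below -/
import Mathlib

section
/- For V₀ < 0, the limit as t → ∞ of ∫₀^t G'_τ(V₀ τ) dτ equals 1/(3|V₀|^{2/3}). -/
open MeasureTheory Real Filter Set

/-- Fourth-order heat kernel `G_t(x) = (1/π)∫₀^∞ e^{−t k⁴} cos(kx) dk`. -/
noncomputable def G (t x : ℝ) : ℝ :=
  (1 / Real.pi) * ∫ k in Set.Ioi (0:ℝ), Real.exp (-t * k ^ 4) * Real.cos (k * x)

/-- First spatial derivative `G_t'(x) = −(1/π)∫₀^∞ k e^{−t k⁴} sin(kx) dk`. -/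
noncomputable def G₁ (t x : ℝ) : ℝ :=
  -(1 / Real.pi) * ∫ k in Set.Ioi (0:ℝ), k * Real.exp (-t * k ^ 4) * Real.sin (k * x)

/-- Second spatial derivative `G_t''(x) = −(1/π)∫₀^∞ k² e^{−t k⁴} cos(kx) dk`. -/
noncomputable def G₂ (t x : ℝ) : ℝ :=
  -(1 / Real.pi) * ∫ k in Set.Ioi (0:ℝ), k ^ 2 * Real.exp (-t * k ^ 4) * Real.cos (k * x)

/-- Self-similar profile `g(z) = (1/π)∫₀^∞ e^{−k⁴} cos(kz) dk`. -/
noncomputable def gprof (z : ℝ) : ℝ :=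
  (1 / Real.pi) * ∫ k in Set.Ioi (0:ℝ), Real.exp (-k ^ 4) * Real.cos (k * z)

/-- An antiderivative of `1 / (1 + x ^ 6)`. -/
noncomputable def invOneAddPowSixPrimitive (x : ℝ) : ℝ :=
  arctan x / 2 + arctan (x ^ 3) / 6 +
    1 / (4 * √3) * Real.log ((x ^ 2 + √3 * x + 1) / (x ^ 2 - √3 * x + 1))

lemma quadratic_factors_pos (x : ℝ) :
    0 < x ^ 2 + √3 * x + 1 ∧ 0 < x ^ 2 - √3 * x + 1 := by
  have h3 : √3 ^ 2 = 3 := Real.sq_sqrt (by norm_num)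
  constructor
  · nlinarith [sq_nonneg (x + √3 / 2)]
  · nlinarith [sq_nonneg (x - √3 / 2)]

lemma hasDerivAt_invOneAddPowSixPrimitive (x : ℝ) :
    HasDerivAt invOneAddPowSixPrimitive (1 / (1 + x ^ 6)) x := by
  obtain ⟨hp, hq⟩ := quadratic_factors_pos x
  have h3 : √3 ^ 2 = 3 := Real.sq_sqrt (by norm_num)
  have hs : 0 < √3 := by positivity
  have hP : HasDerivAt (fun y : ℝ => y ^ 2 + √3 * y + 1) (2 * x + √3) x := by
    simpa using (((hasDerivAt_id x).pow 2).add ((hasDerivAt_id x).const_mul √3)).add_const 1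
  have hQ : HasDerivAt (fun y : ℝ => y ^ 2 - √3 * y + 1) (2 * x - √3) x := by
    simpa using (((hasDerivAt_id x).pow 2).sub ((hasDerivAt_id x).const_mul √3)).add_const 1
  have hlog := ((hP.fun_div hQ hq.ne').log (div_pos hp hq).ne').const_mul (1 / (4 * √3))
  have h := (((hasDerivAt_arctan x).div_const 2).fun_add
    (((hasDerivAt_pow 3 x).arctan).div_const 6)).fun_add hlog
  refine h.congr_deriv ?_
  have hlogEq : 1 / (4 * √3) * (((2 * x + √3) * (x ^ 2 - √3 * x + 1) -
      (x ^ 2 + √3 * x + 1) * (2 * x - √3)) / (x ^ 2 - √3 * x + 1) ^ 2 /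
      ((x ^ 2 + √3 * x + 1) / (x ^ 2 - √3 * x + 1))) =
      (1 - x ^ 2) / (2 * (x ^ 4 - x ^ 2 + 1)) := by
    have hprod : x ^ 4 - x ^ 2 + 1 = (x ^ 2 + √3 * x + 1) * (x ^ 2 - √3 * x + 1) := by
      linear_combination x ^ 2 * h3
    rw [hprod]
    have := hp.ne'
    have := hq.ne'
    field_simp
    ring
  rw [hlogEq]
  have h4 : 0 < x ^ 4 - x ^ 2 + 1 := by nlinarith [sq_nonneg (x ^ 2 - 1 / 2)]
  have h6 : 1 + x ^ 6 = (1 + x ^ 2) * (x ^ 4 - x ^ 2 + 1) := by ring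
  have h6' : 1 + (x ^ 3) ^ 2 = (1 + x ^ 2) * (x ^ 4 - x ^ 2 + 1) := by ring
  rw [h6, h6']
  have h2 : 1 + x ^ 2 ≠ 0 := by positivity
  have h4' := h4.ne'
  generalize hQ4 : x ^ 4 - x ^ 2 + 1 = q at h4'
  push_cast
  field_simp
  rw [← hQ4]
  ring

lemma tendsto_invOneAddPowSixPrimitive :
    Tendsto invOneAddPowSixPrimitive atTop (nhds (π / 3)) := by
  have harc : Tendsto arctan atTop (nhds (π / 2)) :=
    tendsto_nhds_of_tendsto_nhdsWithin tendsto_arctan_atTop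
  have hratio : Tendsto (fun x : ℝ => (x ^ 2 + √3 * x + 1) / (x ^ 2 - √3 * x + 1)) atTop
      (nhds 1) := by
    have hi : Tendsto (fun x : ℝ => x⁻¹) atTop (nhds 0) := tendsto_inv_atTop_zero
    have h : Tendsto (fun x : ℝ => (1 + √3 * x⁻¹ + x⁻¹ ^ 2) / (1 - √3 * x⁻¹ + x⁻¹ ^ 2)) atTop
        (nhds ((1 + √3 * 0 + 0 ^ 2) / (1 - √3 * 0 + 0 ^ 2))) :=
      ((tendsto_const_nhds.add (hi.const_mul _)).add (hi.pow 2)).div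
        ((tendsto_const_nhds.sub (hi.const_mul _)).add (hi.pow 2)) (by norm_num)
    norm_num at h
    refine h.congr' ?_
    filter_upwards [eventually_gt_atTop 0] with x hx
    have := (quadratic_factors_pos x).2.ne'
    have h2 : 1 - √3 * x⁻¹ + (x ^ 2)⁻¹ = (x ^ 2 - √3 * x + 1) / x ^ 2 := by
      field_simp
    have h1 : 1 + √3 * x⁻¹ + (x ^ 2)⁻¹ = (x ^ 2 + √3 * x + 1) / x ^ 2 := by
      field_simp
    simp only [h1, h2]
    field_simp
  have hlog := (hratio.log one_ne_zero).const_mul (1 / (4 * √3))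
  have h := ((harc.div_const 2).add
    ((harc.comp (tendsto_pow_atTop (n := 3) (by norm_num))).div_const 6)).add hlog
  rw [Real.log_one] at h
  rwa [show π / 2 / 2 + π / 2 / 6 + 1 / (4 * √3) * 0 = π / 3 by ring] at h

lemma integral_Ioi_inv_one_add_pow_six :
    ∫ x in Ioi (0:ℝ), 1 / (1 + x ^ 6) = π / 3 := by
  rw [integral_Ioi_of_hasDerivAt_of_nonneg' (fun x _ => hasDerivAt_invOneAddPowSixPrimitive x)
    (fun x _ => by positivity) tendsto_invOneAddPowSixPrimitive]
  simp [invOneAddPowSixPrimitive]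

lemma integral_Ioi_cube_div_pow_six_add {a : ℝ} (ha : 0 < a) :
    ∫ k in Ioi (0:ℝ), a ^ 3 / (k ^ 6 + (a ^ 3) ^ 2) = π / (3 * a ^ 2) := by
  have h := integral_comp_mul_left_Ioi (fun k : ℝ => a ^ 3 / (k ^ 6 + (a ^ 3) ^ 2)) 0 ha
  have he : ∀ x : ℝ, a ^ 3 / ((a * x) ^ 6 + (a ^ 3) ^ 2) = (a ^ 3)⁻¹ * (1 / (1 + x ^ 6)) := by
    intro x
    have : 1 + x ^ 6 ≠ 0 := by positivity
    have : (a * x) ^ 6 + (a ^ 3) ^ 2 ≠ 0 := by positivity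
    field_simp
    ring
  simp only [he, mul_zero, smul_eq_mul] at h
  rw [integral_const_mul, integral_Ioi_inv_one_add_pow_six] at h
  field_simp at h ⊢
  linarith

lemma integral_exp_neg_mul_sin {c k : ℝ} (hc : 0 < c) (hk : 0 < k) (t : ℝ) :
    ∫ τ in (0:ℝ)..t, k * Real.exp (-τ * k ^ 4) * Real.sin (k * (-c * τ)) =
      -((c - Real.exp (-t * k ^ 4) * (k ^ 3 * Real.sin (c * k * t) + c * Real.cos (c * k * t))) /
        (k ^ 6 + c ^ 2)) := by
  have hd : k ^ 6 + c ^ 2 ≠ 0 := by positivity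
  have hderiv : ∀ τ : ℝ, HasDerivAt (fun τ : ℝ => Real.exp (-τ * k ^ 4) *
      (k ^ 3 * Real.sin (c * k * τ) + c * Real.cos (c * k * τ)) / (k ^ 6 + c ^ 2))
      (k * Real.exp (-τ * k ^ 4) * Real.sin (k * (-c * τ))) τ := by
    intro τ
    have he : HasDerivAt (fun τ : ℝ => Real.exp (-τ * k ^ 4))
        (Real.exp (-τ * k ^ 4) * (-k ^ 4)) τ := by
      simpa using (((hasDerivAt_id τ).neg).mul_const (k ^ 4)).exp
    have hl : HasDerivAt (fun τ : ℝ => c * k * τ) (c * k) τ := by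
      simpa using (hasDerivAt_id τ).const_mul (c * k)
    have h := (he.fun_mul ((hl.sin.const_mul (k ^ 3)).fun_add (hl.cos.const_mul c))).div_const
      (k ^ 6 + c ^ 2)
    refine h.congr_deriv ?_
    have hsin : Real.sin (k * (-c * τ)) = -Real.sin (c * k * τ) := by
      rw [← Real.sin_neg]; ring_nf
    rw [hsin]
    field_simp
    ring
  rw [intervalIntegral.integral_eq_sub_of_hasDerivAt (fun τ _ => hderiv τ)
    (Continuous.intervalIntegrable (by fun_prop) _ _)]
  simp
  ring

lemma mul_integral_exp_neg_mul_le {k t : ℝ} (hk : 0 < k) (ht : 0 ≤ t) :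
    k * ∫ τ in (0:ℝ)..t, Real.exp (-τ * k ^ 4) ≤ 2 * (t + 1) * (1 + k ^ 2)⁻¹ := by
  rw [← div_eq_mul_inv, le_div_iff₀ (by positivity)]
  rcases le_total k 1 with h1 | h1
  · have hle : ∫ τ in (0:ℝ)..t, Real.exp (-τ * k ^ 4) ≤ ∫ τ in (0:ℝ)..t, (1:ℝ) := by
      refine intervalIntegral.integral_mono_on ht
        (Continuous.intervalIntegrable (by fun_prop) _ _) (by simp) fun τ hτ => ?_
      rw [Real.exp_le_one_iff]
      have := mul_nonneg hτ.1 (by positivity : 0 ≤ k ^ 4)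
      linarith
    simp only [intervalIntegral.integral_const, sub_zero, smul_eq_mul, mul_one] at hle
    have h0 : 0 ≤ ∫ τ in (0:ℝ)..t, Real.exp (-τ * k ^ 4) :=
      intervalIntegral.integral_nonneg ht fun τ _ => (Real.exp_pos _).le
    calc _ ≤ (1 * t) * (1 + 1 ^ 2) := by gcongr
      _ ≤ _ := by linarith
  · have hval : ∫ τ in (0:ℝ)..t, Real.exp (-τ * k ^ 4) = (1 - Real.exp (-t * k ^ 4)) / k ^ 4 := by
      have hd : ∀ τ : ℝ, HasDerivAt (fun τ : ℝ => -Real.exp (-τ * k ^ 4) / k ^ 4)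
          (Real.exp (-τ * k ^ 4)) τ := by
        intro τ
        have h := ((((hasDerivAt_id τ).neg).mul_const (k ^ 4)).exp.neg).div_const (k ^ 4)
        refine h.congr_deriv ?_
        simp
        field_simp
      rw [intervalIntegral.integral_eq_sub_of_hasDerivAt (fun τ _ => hd τ)
        (Continuous.intervalIntegrable (by fun_prop) _ _)]
      simp
      ring
    have hle : ∫ τ in (0:ℝ)..t, Real.exp (-τ * k ^ 4) ≤ 1 / k ^ 4 := by
      rw [hval]
      gcongr
      linarith [Real.exp_pos (-t * k ^ 4)]
    calc _ ≤ k * (1 / k ^ 4) * (1 + k ^ 2) := by gcongr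
      _ = (1 + k ^ 2) / k ^ 3 := by field_simp
      _ ≤ 2 := by
        rw [div_le_iff₀ (by positivity)]
        nlinarith [mul_nonneg (sub_nonneg.2 h1) (sq_nonneg k)]
      _ ≤ _ := by linarith

lemma integrable_prod_exp_neg_mul_sin {t : ℝ} (ht : 0 ≤ t) (v : ℝ) :
    Integrable (Function.uncurry fun τ k : ℝ =>
      k * Real.exp (-τ * k ^ 4) * Real.sin (k * (v * τ)))
      ((volume.restrict (Ioc 0 t)).prod (volume.restrict (Ioi 0))) := by
  have hcont : Continuous (Function.uncurry fun τ k : ℝ =>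
      k * Real.exp (-τ * k ^ 4) * Real.sin (k * (v * τ))) := by
    unfold Function.uncurry
    fun_prop
  have hmeas := hcont.aestronglyMeasurable
    (μ := (volume.restrict (Ioc 0 t)).prod (volume.restrict (Ioi (0:ℝ))))
  rw [integrable_prod_iff' hmeas]
  constructor
  · refine Eventually.of_forall fun k => ?_
    refine (Continuous.integrableOn_Icc ?_).mono_set Ioc_subset_Icc_self
    simp only [Function.uncurry]
    fun_prop
  · refine Integrable.mono' ((integrable_inv_one_add_sq.const_mul (2 * (t + 1))).integrableOn)
      hmeas.norm.prod_swap.integral_prod_right' ?_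
    filter_upwards [ae_restrict_mem measurableSet_Ioi] with k hk
    have hk : 0 < k := hk
    refine le_trans ?_ (mul_integral_exp_neg_mul_le hk ht)
    rw [Real.norm_of_nonneg (integral_nonneg fun _ => norm_nonneg _),
      ← intervalIntegral.integral_of_le ht, ← intervalIntegral.integral_const_mul]
    refine intervalIntegral.integral_mono_on ht
      (Continuous.intervalIntegrable (by simp only [Function.uncurry]; fun_prop) _ _)
      (Continuous.intervalIntegrable (by fun_prop) _ _) fun τ _ => ?_
    simp only [Function.uncurry, norm_mul, Real.norm_eq_abs, abs_of_pos hk, Real.abs_exp]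
    exact mul_le_of_le_one_right (by positivity) (Real.abs_sin_le_one _)

lemma integral_G₁_neg_mul {c t : ℝ} (hc : 0 < c) (ht : 0 ≤ t) :
    ∫ τ in (0:ℝ)..t, G₁ τ (-c * τ) = 1 / π * ∫ k in Ioi (0:ℝ),
      (c - Real.exp (-t * k ^ 4) * (k ^ 3 * Real.sin (c * k * t) + c * Real.cos (c * k * t))) /
        (k ^ 6 + c ^ 2) := by
  simp only [G₁]
  rw [intervalIntegral.integral_const_mul, intervalIntegral.integral_of_le ht,
    integral_integral_swap (integrable_prod_exp_neg_mul_sin ht (-c)), neg_mul, ← mul_neg,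
    ← integral_neg]
  congr 1
  refine setIntegral_congr_fun measurableSet_Ioi fun k hk => ?_
  rw [← intervalIntegral.integral_of_le ht, integral_exp_neg_mul_sin hc hk, neg_neg]

lemma integrableOn_cube_div_pow_six_add {c : ℝ} (hc : 0 < c) :
    IntegrableOn (fun k : ℝ => (2 * c + k ^ 3) / (k ^ 6 + c ^ 2)) (Ioi 0) := by
  refine Integrable.mono'
    ((integrable_inv_one_add_sq.const_mul (2 * (2 * c + 1) * (1 + 1 / c ^ 2))).integrableOn)
    (Continuous.aestronglyMeasurable
      (Continuous.div (by fun_prop) (by fun_prop) fun k => by positivity)) ?_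
  filter_upwards [ae_restrict_mem measurableSet_Ioi] with k hk
  have hk : 0 < k := hk
  rw [Real.norm_of_nonneg (by positivity), ← div_eq_mul_inv,
    div_le_div_iff₀ (by positivity) (by positivity)]
  rcases le_total k 1 with h1 | h1
  · calc (2 * c + k ^ 3) * (1 + k ^ 2) ≤ (2 * c + 1 ^ 3) * (1 + 1 ^ 2) := by gcongr
      _ = 2 * (2 * c + 1) * (1 / c ^ 2) * (0 + c ^ 2) := by field_simp; ring
      _ ≤ _ := by gcongr <;> first | positivity | linarith
  · calc (2 * c + k ^ 3) * (1 + k ^ 2) ≤ (2 * c * k ^ 3 + k ^ 3) * (k ^ 2 + k ^ 2) := by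
          have h3 : 2 * c ≤ 2 * c * k ^ 3 :=
            le_mul_of_one_le_right (by positivity) (one_le_pow₀ h1)
          gcongr
          exact one_le_pow₀ h1
      _ = 2 * (2 * c + 1) * 1 * k ^ 5 := by ring
      _ ≤ 2 * (2 * c + 1) * (1 + 1 / c ^ 2) * (k ^ 6 + c ^ 2) := by
          have : k ^ 5 ≤ k ^ 6 := pow_le_pow_right₀ h1 (by norm_num)
          gcongr
          · have : 0 < 1 / c ^ 2 := by positivity
            linarith
          · nlinarith [sq_nonneg c]

lemma abs_cube_mul_sin_add_mul_cos_le {c k : ℝ} (hc : 0 < c) (hk : 0 < k) (x : ℝ) :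
    |k ^ 3 * Real.sin x + c * Real.cos x| ≤ k ^ 3 + c := by
  refine (abs_add_le _ _).trans ?_
  rw [abs_mul, abs_mul, abs_of_pos hc, abs_of_pos (pow_pos hk 3)]
  gcongr
  · exact mul_le_of_le_one_right (by positivity) (Real.abs_sin_le_one _)
  · exact mul_le_of_le_one_right hc.le (Real.abs_cos_le_one _)

lemma tendsto_integral_damped {c : ℝ} (hc : 0 < c) :
    Tendsto (fun t : ℝ => ∫ k in Ioi (0:ℝ),
      (c - Real.exp (-t * k ^ 4) * (k ^ 3 * Real.sin (c * k * t) + c * Real.cos (c * k * t))) /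
        (k ^ 6 + c ^ 2)) atTop (nhds (∫ k in Ioi (0:ℝ), c / (k ^ 6 + c ^ 2))) := by
  refine tendsto_integral_filter_of_dominated_convergence
    (fun k : ℝ => (2 * c + k ^ 3) / (k ^ 6 + c ^ 2)) ?_ ?_
    (integrableOn_cube_div_pow_six_add hc) ?_
  · exact Eventually.of_forall fun t => Continuous.aestronglyMeasurable
      (Continuous.div (by fun_prop) (by fun_prop) fun k => by positivity)
  · filter_upwards [eventually_ge_atTop 0] with t ht
    filter_upwards [ae_restrict_mem measurableSet_Ioi] with k hk
    have hk : 0 < k := hk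
    rw [norm_div, Real.norm_of_nonneg (by positivity : 0 ≤ k ^ 6 + c ^ 2)]
    gcongr
    refine (norm_sub_le _ _).trans ?_
    rw [norm_mul, Real.norm_of_nonneg hc.le, Real.norm_of_nonneg (Real.exp_pos _).le]
    have he : Real.exp (-t * k ^ 4) ≤ 1 := by
      rw [Real.exp_le_one_iff]
      have := mul_nonneg ht (by positivity : 0 ≤ k ^ 4)
      linarith
    have := (mul_le_of_le_one_left (abs_nonneg _) he).trans
      (abs_cube_mul_sin_add_mul_cos_le hc hk (c * k * t))
    rw [Real.norm_eq_abs]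
    linarith
  · filter_upwards [ae_restrict_mem measurableSet_Ioi] with k hk
    have hk : 0 < k := hk
    have he : Tendsto (fun t : ℝ => Real.exp (-t * k ^ 4)) atTop (nhds 0) :=
      Real.tendsto_exp_atBot.comp
        (tendsto_neg_atTop_atBot.atBot_mul_const (by positivity))
    have h0 : Tendsto (fun t : ℝ => Real.exp (-t * k ^ 4) *
        (k ^ 3 * Real.sin (c * k * t) + c * Real.cos (c * k * t))) atTop (nhds 0) := by
      refine squeeze_zero_norm (a := fun t => Real.exp (-t * k ^ 4) * (k ^ 3 + c))
        (fun t => ?_) (by simpa using he.mul_const (k ^ 3 + c))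
      rw [norm_mul, Real.norm_of_nonneg (Real.exp_pos _).le]
      exact mul_le_mul_of_nonneg_left (abs_cube_mul_sin_add_mul_cos_le hc hk _)
        (Real.exp_pos _).le
    simpa using (tendsto_const_nhds (x := c) |>.sub h0).div_const (k ^ 6 + c ^ 2)

/-- For `V₀ < 0`, `∫₀^t G'_τ(V₀ τ) dτ → 1/(3|V₀|^{2/3})` as `t → ∞`. -/
theorem stmt2 (V₀ : ℝ) (hV₀ : V₀ < 0) :
    Tendsto (fun t : ℝ => ∫ τ in (0:ℝ)..t, G₁ τ (V₀ * τ)) atTop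
      (nhds (1 / (3 * |V₀| ^ ((2:ℝ)/3)))) := by
  obtain ⟨a, ha, hVa⟩ : ∃ a : ℝ, 0 < a ∧ |V₀| = a ^ 3 :=
    ⟨|V₀| ^ ((1:ℝ) / 3), Real.rpow_pos_of_pos (abs_pos.2 hV₀.ne) _, by
      rw [← Real.rpow_mul_natCast (abs_nonneg _)]; norm_num⟩
  have hpow : |V₀| ^ ((2:ℝ) / 3) = a ^ 2 := by
    rw [hVa, ← Real.rpow_natCast_mul ha.le]
    norm_num
  have hV : V₀ = -a ^ 3 := by
    rw [← hVa, abs_of_neg hV₀, neg_neg]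
  have hc : 0 < a ^ 3 := by positivity
  have h := (tendsto_integral_damped hc).const_mul (1 / π)
  rw [integral_Ioi_cube_div_pow_six_add ha] at h
  rw [hpow, show 1 / (3 * a ^ 2) = 1 / π * (π / (3 * a ^ 2)) by field_simp]
  refine h.congr' ?_
  filter_upwards [eventually_ge_atTop 0] with t ht
  rw [hV, integral_G₁_neg_mul hc ht]
end

section
/- For V₀ < 0, the limit as t → ∞ of ∫₀^t G''_τ(V₀ τ) dτ equals −1/(3|V₀|^{1/3}). -/
open MeasureTheory Real Filter Set

theorem hasDerivAt_primitive_pow_four_div (s : ℝ) :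
    HasDerivAt (fun s : ℝ => (1 / 3) * (arctan s + (1 / 2) * (arctan (2 * s + √3)
      + arctan (2 * s - √3)) - (√3 / 4) * (Real.log (s ^ 2 + √3 * s + 1)
      - Real.log (s ^ 2 - √3 * s + 1)))) (s ^ 4 / (s ^ 6 + 1)) s := by
  have h3 : √3 ^ 2 = 3 := Real.sq_sqrt (by norm_num)
  have hp : 0 < s ^ 2 + √3 * s + 1 := by nlinarith [sq_nonneg (2 * s + √3)]
  have hm : 0 < s ^ 2 - √3 * s + 1 := by nlinarith [sq_nonneg (2 * s - √3)]
  have hid := hasDerivAt_id' s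
  have hlin : HasDerivAt (fun s : ℝ => √3 * s) √3 s := by simpa using hid.const_mul √3
  have htwo : HasDerivAt (fun s : ℝ => 2 * s) 2 s := by simpa using hid.const_mul 2
  have hsq : HasDerivAt (fun s : ℝ => s ^ 2) (2 * s) s := by simpa using hasDerivAt_pow 2 s
  have h := (((hasDerivAt_arctan s).add
    (((htwo.add_const √3).arctan.add (htwo.sub_const √3).arctan).const_mul (1 / 2))).sub
    (((((hsq.add hlin).add_const 1).log hp.ne').sub
      (((hsq.sub hlin).add_const 1).log hm.ne')).const_mul (√3 / 4))).const_mul (1 / 3)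
  refine h.congr_deriv ?_
  have e1 : 1 + (2 * s + √3) ^ 2 = 4 * (s ^ 2 + √3 * s + 1) := by linear_combination h3
  have e2 : 1 + (2 * s - √3) ^ 2 = 4 * (s ^ 2 - √3 * s + 1) := by linear_combination h3
  have e3 : s ^ 6 + 1 = (1 + s ^ 2) * ((s ^ 2 + √3 * s + 1) * (s ^ 2 - √3 * s + 1)) := by
    linear_combination (1 + s ^ 2) * s ^ 2 * h3
  have hs : 0 < 1 + s ^ 2 := by positivity
  simp only [Pi.add_apply, Pi.sub_apply]
  rw [e1, e2, e3]
  obtain ⟨P, hP⟩ : ∃ P, s ^ 2 + √3 * s + 1 = P := ⟨_, rfl⟩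
  obtain ⟨M, hM⟩ : ∃ M, s ^ 2 - √3 * s + 1 = M := ⟨_, rfl⟩
  rw [hP] at hp
  rw [hM] at hm
  rw [hP, hM]
  field_simp
  rw [← hP, ← hM]
  ring_nf
  simp only [h3]
  ring

theorem tendsto_primitive_pow_four_div :
    Tendsto (fun s : ℝ => (1 / 3) * (arctan s + (1 / 2) * (arctan (2 * s + √3)
      + arctan (2 * s - √3)) - (√3 / 4) * (Real.log (s ^ 2 + √3 * s + 1)
      - Real.log (s ^ 2 - √3 * s + 1)))) atTop (nhds (π / 3)) := by
  have harc : Tendsto arctan atTop (nhds (π / 2)) :=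
    tendsto_arctan_atTop.mono_right nhdsWithin_le_nhds
  have htwo : Tendsto (fun s : ℝ => 2 * s) atTop atTop :=
    tendsto_id.const_mul_atTop (by norm_num)
  have hA := harc.comp (tendsto_atTop_add_const_right atTop √3 htwo)
  have hB := harc.comp (tendsto_atTop_add_const_right atTop (-√3) htwo)
  have hinv := tendsto_inv_atTop_zero (𝕜 := ℝ)
  have hnum : Tendsto (fun s : ℝ => 1 + √3 * s⁻¹ + s⁻¹ ^ 2) atTop (nhds 1) := by
    simpa using ((hinv.const_mul √3).const_add 1).add (hinv.pow 2)
  have hden : Tendsto (fun s : ℝ => 1 - √3 * s⁻¹ + s⁻¹ ^ 2) atTop (nhds 1) := by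
    simpa using ((hinv.const_mul √3).const_sub 1).add (hinv.pow 2)
  have hlog : Tendsto (fun s : ℝ => Real.log (s ^ 2 + √3 * s + 1)
      - Real.log (s ^ 2 - √3 * s + 1)) atTop (nhds 0) := by
    have h := (hnum.log one_ne_zero).sub (hden.log one_ne_zero)
    rw [sub_self] at h
    refine h.congr' ?_
    filter_upwards [eventually_gt_atTop 0] with s hs
    have h3 : √3 ^ 2 = 3 := Real.sq_sqrt (by norm_num)
    have hp : 0 < s ^ 2 + √3 * s + 1 := by positivity
    have hm : 0 < s ^ 2 - √3 * s + 1 := by nlinarith [sq_nonneg (2 * s - √3)]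
    have e1 : 1 + √3 * s⁻¹ + s⁻¹ ^ 2 = (s ^ 2 + √3 * s + 1) / s ^ 2 := by field_simp
    have e2 : 1 - √3 * s⁻¹ + s⁻¹ ^ 2 = (s ^ 2 - √3 * s + 1) / s ^ 2 := by field_simp
    rw [e1, e2, Real.log_div hp.ne' (by positivity), Real.log_div hm.ne' (by positivity)]
    ring
  have h := ((harc.add ((hA.add hB).const_mul (1 / 2))).sub
    (hlog.const_mul (√3 / 4))).const_mul (1 / 3)
  convert h using 2
  · simp only [Function.comp_apply, sub_eq_add_neg]
  · ring

theorem integrableOn_pow_four_div :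
    IntegrableOn (fun s : ℝ => s ^ 4 / (s ^ 6 + 1)) (Ioi 0) :=
  integrableOn_Ioi_deriv_of_nonneg' (fun s _ => hasDerivAt_primitive_pow_four_div s)
    (fun s _ => by positivity) tendsto_primitive_pow_four_div

theorem integral_pow_four_div : ∫ s in Ioi (0:ℝ), s ^ 4 / (s ^ 6 + 1) = π / 3 := by
  rw [integral_Ioi_of_hasDerivAt_of_nonneg' (fun s _ => hasDerivAt_primitive_pow_four_div s)
    (fun s _ => by positivity) tendsto_primitive_pow_four_div]
  simp [Real.arctan_neg]

theorem pow_four_div_add_pow_six {c : ℝ} (hc : 0 < c) (k : ℝ) :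
    k ^ 4 / (k ^ 6 + c ^ 6) =
      (c ^ 2)⁻¹ * ((c⁻¹ * k) ^ 4 / ((c⁻¹ * k) ^ 6 + 1)) := by
  have h1 : 0 < k ^ 6 + c ^ 6 := by positivity
  have h2 : 0 < (c⁻¹ * k) ^ 6 + 1 := by positivity
  have h3 : (c⁻¹ * k) ^ 6 + 1 = (k ^ 6 + c ^ 6) / c ^ 6 := by field_simp
  rw [h3]
  field_simp

theorem integrableOn_pow_four_div_add_pow_six {c : ℝ} (hc : 0 < c) :
    IntegrableOn (fun k : ℝ => k ^ 4 / (k ^ 6 + c ^ 6)) (Ioi 0) := by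
  simp_rw [pow_four_div_add_pow_six hc]
  refine Integrable.const_mul ?_ _
  have h := integrableOn_Ioi_comp_mul_left_iff (fun s : ℝ => s ^ 4 / (s ^ 6 + 1)) 0
    (inv_pos.2 hc)
  rw [mul_zero] at h
  exact h.2 integrableOn_pow_four_div

theorem integral_pow_four_div_add_pow_six {c : ℝ} (hc : 0 < c) :
    ∫ k in Ioi (0:ℝ), k ^ 4 / (k ^ 6 + c ^ 6) = π / (3 * c) := by
  simp_rw [pow_four_div_add_pow_six hc]
  rw [integral_const_mul,
    integral_comp_mul_left_Ioi (fun s : ℝ => s ^ 4 / (s ^ 6 + 1)) 0 (inv_pos.2 hc),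
    mul_zero, integral_pow_four_div, smul_eq_mul]
  field_simp

theorem integral_exp_neg_mul_cos (p b t : ℝ) (h : p ^ 2 + b ^ 2 ≠ 0) :
    ∫ τ in (0:ℝ)..t, Real.exp (-τ * p) * Real.cos (b * τ) =
      (p + Real.exp (-t * p) * (b * Real.sin (b * t) - p * Real.cos (b * t)))
        / (p ^ 2 + b ^ 2) := by
  have hd : ∀ τ ∈ uIcc 0 t, HasDerivAt (fun τ : ℝ => Real.exp (-τ * p)
      * (b * Real.sin (b * τ) - p * Real.cos (b * τ)) / (p ^ 2 + b ^ 2))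
      (Real.exp (-τ * p) * Real.cos (b * τ)) τ := by
    intro τ _
    have hid := hasDerivAt_id' τ
    have hb : HasDerivAt (fun τ : ℝ => b * τ) b τ := by simpa using hid.const_mul b
    have hp : HasDerivAt (fun τ : ℝ => -τ * p) (-p) τ := by simpa using hid.neg.mul_const p
    refine ((hp.exp.mul ((hb.sin.const_mul b).sub (hb.cos.const_mul p))).div_const
      (p ^ 2 + b ^ 2)).congr_deriv ?_
    field_simp
    simp only [Pi.sub_apply, mul_comm τ b]
    ring
  rw [intervalIntegral.integral_eq_sub_of_hasDerivAt hd
    ((by fun_prop : Continuous _).intervalIntegrable _ _)]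
  simp
  ring

theorem integrableOn_sq_mul_exp_neg_mul_pow_four {τ : ℝ} (hτ : 0 < τ) :
    IntegrableOn (fun k : ℝ => k ^ 2 * Real.exp (-τ * k ^ 4)) (Ioi 0) := by
  have h := integrableOn_rpow_mul_exp_neg_mul_rpow (p := 4) (s := 2) (b := τ)
    (by norm_num) (by norm_num) hτ
  simpa using h

theorem integral_sq_mul_exp_neg_mul_pow_four {τ : ℝ} (hτ : 0 < τ) :
    ∫ k in Ioi (0:ℝ), k ^ 2 * Real.exp (-τ * k ^ 4) =
      τ ^ (-(3 / 4) : ℝ) * (1 / 4 * Real.Gamma (3 / 4)) := by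
  have h := integral_rpow_mul_exp_neg_mul_rpow (p := 4) (q := 2) (b := τ)
    (by norm_num) (by norm_num) hτ
  norm_num at h
  norm_num
  rw [h]
  ring

theorem integrable_sq_mul_exp_mul_cos_prod (V t : ℝ) (ht : 0 ≤ t) :
    Integrable (Function.uncurry fun τ k : ℝ =>
        k ^ 2 * Real.exp (-τ * k ^ 4) * Real.cos (k * (V * τ)))
      ((volume.restrict (Ioc 0 t)).prod (volume.restrict (Ioi 0))) := by
  have hdom : Integrable (Function.uncurry fun τ k : ℝ => k ^ 2 * Real.exp (-τ * k ^ 4))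
      ((volume.restrict (Ioc 0 t)).prod (volume.restrict (Ioi 0))) := by
    refine (integrable_prod_iff
      (by fun_prop : Continuous _).aestronglyMeasurable).2 ⟨?_, ?_⟩
    · filter_upwards [ae_restrict_mem measurableSet_Ioc] with τ hτ
      exact integrableOn_sq_mul_exp_neg_mul_pow_four hτ.1
    · have hi : IntegrableOn (fun τ : ℝ => τ ^ (-(3 / 4) : ℝ) * (1 / 4 * Real.Gamma (3 / 4)))
          (Ioc 0 t) :=
        ((intervalIntegrable_iff_integrableOn_Ioc_of_le ht).1
          (intervalIntegral.intervalIntegrable_rpow' (by norm_num))).mul_const _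
      refine hi.congr ?_
      filter_upwards [ae_restrict_mem measurableSet_Ioc] with τ hτ
      rw [← integral_sq_mul_exp_neg_mul_pow_four hτ.1]
      refine integral_congr_ae (Eventually.of_forall fun k => ?_)
      simp only [Function.uncurry_apply_pair]
      rw [Real.norm_of_nonneg (by positivity)]
  refine hdom.mono (by fun_prop : Continuous _).aestronglyMeasurable
    (Eventually.of_forall fun x => ?_)
  simp only [Function.uncurry]
  rw [norm_mul]
  exact mul_le_of_le_one_right (norm_nonneg _) (Real.abs_cos_le_one _)

theorem intervalIntegral_G₂ {V t : ℝ} (hV : V ≠ 0) (ht : 0 ≤ t) :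
    ∫ τ in (0:ℝ)..t, G₂ τ (V * τ) = -(1 / π) * ∫ k in Ioi (0:ℝ),
      (k ^ 4 / (k ^ 6 + V ^ 2) + k ^ 2 * (Real.exp (-t * k ^ 4) *
        (k * V * Real.sin (k * V * t) - k ^ 4 * Real.cos (k * V * t))
          / ((k ^ 4) ^ 2 + (k * V) ^ 2))) := by
  unfold G₂
  rw [intervalIntegral.integral_const_mul, intervalIntegral.integral_of_le ht,
    integral_integral_swap (integrable_sq_mul_exp_mul_cos_prod V t ht)]
  congr 1
  refine setIntegral_congr_fun measurableSet_Ioi fun k hk => ?_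
  have hk : 0 < k := hk
  have hV2 : 0 < V ^ 2 := by positivity
  have h0 : (k ^ 4) ^ 2 + (k * V) ^ 2 ≠ 0 := by positivity
  have h1 : k ^ 6 + V ^ 2 ≠ 0 := by positivity
  have e : (k ^ 4) ^ 2 + (k * V) ^ 2 = k ^ 2 * (k ^ 6 + V ^ 2) := by ring
  simp only [mul_assoc (k ^ 2), ← mul_assoc k V]
  rw [← intervalIntegral.integral_of_le ht, intervalIntegral.integral_const_mul,
    integral_exp_neg_mul_cos (k ^ 4) (k * V) t h0, e]
  field_simp

theorem abs_sq_mul_exp_mul_div_le {V t k : ℝ} (hV : V ≠ 0) (hk : 0 < k) :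
    |k ^ 2 * (Real.exp (-t * k ^ 4) *
        (k * V * Real.sin (k * V * t) - k ^ 4 * Real.cos (k * V * t))
          / ((k ^ 4) ^ 2 + (k * V) ^ 2))| ≤ 2 / |V| * (k * Real.exp (-t * k ^ 4)) := by
  have hV' : 0 < |V| := abs_pos.2 hV
  have hnum : |k * V * Real.sin (k * V * t) - k ^ 4 * Real.cos (k * V * t)|
      ≤ k * |V| + k ^ 4 := by
    refine (abs_sub _ _).trans ?_
    rw [abs_mul, abs_mul, abs_mul, abs_of_pos hk, abs_of_pos (pow_pos hk 4)]
    exact add_le_add (mul_le_of_le_one_right (by positivity) (Real.abs_sin_le_one _))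
      (mul_le_of_le_one_right (by positivity) (Real.abs_cos_le_one _))
  have e : (k ^ 4) ^ 2 + (k * V) ^ 2 = (k ^ 4) ^ 2 + (k * |V|) ^ 2 := by
    rw [mul_pow, mul_pow, sq_abs]
  have hfrac : (k * |V| + k ^ 4) / ((k ^ 4) ^ 2 + (k * |V|) ^ 2) ≤ 2 / (k * |V|) := by
    rw [div_le_div_iff₀ (by positivity) (by positivity)]
    nlinarith [sq_nonneg (k ^ 4 - k * |V|), sq_nonneg (k ^ 4), sq_nonneg (k * |V|)]
  rw [abs_mul, abs_div, abs_mul, Real.abs_exp, abs_of_pos (pow_pos hk 2), e,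
    abs_of_pos (by positivity : 0 < (k ^ 4) ^ 2 + (k * |V|) ^ 2), mul_div_assoc]
  calc _ ≤ k ^ 2 * (Real.exp (-t * k ^ 4) * (2 / (k * |V|))) := by
        refine mul_le_mul_of_nonneg_left (mul_le_mul_of_nonneg_left ?_ (Real.exp_pos _).le)
          (sq_nonneg k)
        exact (div_le_div_of_nonneg_right hnum (by positivity)).trans hfrac
    _ = _ := by field_simp

/-- For `V₀ < 0`, `∫₀^t G''_τ(V₀ τ) dτ → −1/(3|V₀|^{1/3})` as `t → ∞`. -/
theorem stmt3 (V₀ : ℝ) (hV₀ : V₀ < 0) :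
    Tendsto (fun t : ℝ => ∫ τ in (0:ℝ)..t, G₂ τ (V₀ * τ)) atTop
      (nhds (-(1 / (3 * |V₀| ^ ((1:ℝ)/3))))) := by
  have hV : V₀ ≠ 0 := hV₀.ne
  set c : ℝ := |V₀| ^ ((1:ℝ) / 3) with hc_def
  have hc : 0 < c := Real.rpow_pos_of_pos (abs_pos.2 hV) _
  have hc6 : V₀ ^ 2 = c ^ 6 := by
    rw [← sq_abs, hc_def, ← Real.rpow_natCast (|V₀| ^ ((1:ℝ) / 3)),
      ← Real.rpow_mul (abs_nonneg _), ← Real.rpow_natCast]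
    norm_num
  have hint : IntegrableOn (fun k : ℝ => k * Real.exp (-1 * k ^ 4)) (Ioi 0) := by
    have h := integrableOn_rpow_mul_exp_neg_mul_rpow (p := 4) (s := 1) (b := 1)
      (by norm_num) (by norm_num) one_pos
    simpa using h
  have hlim : Tendsto (fun t : ℝ => ∫ k in Ioi (0:ℝ),
      (k ^ 4 / (k ^ 6 + V₀ ^ 2) + k ^ 2 * (Real.exp (-t * k ^ 4) *
        (k * V₀ * Real.sin (k * V₀ * t) - k ^ 4 * Real.cos (k * V₀ * t))
          / ((k ^ 4) ^ 2 + (k * V₀) ^ 2)))) atTop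
      (nhds (∫ k in Ioi (0:ℝ), k ^ 4 / (k ^ 6 + V₀ ^ 2))) := by
    refine tendsto_integral_filter_of_dominated_convergence
      (fun k => k ^ 4 / (k ^ 6 + V₀ ^ 2) + 2 / |V₀| * (k * Real.exp (-1 * k ^ 4)))
      (Eventually.of_forall fun t => (by fun_prop : Measurable _).aestronglyMeasurable)
      ?_ ?_ ?_
    · filter_upwards [eventually_ge_atTop 1] with t ht
      filter_upwards [ae_restrict_mem measurableSet_Ioi] with k hk
      have hk : 0 < k := hk
      refine (norm_add_le _ _).trans (add_le_add ?_ ?_)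
      · rw [Real.norm_of_nonneg (by positivity)]
      · refine (abs_sq_mul_exp_mul_div_le hV hk).trans ?_
        gcongr
    · refine Integrable.add ?_ (hint.const_mul _)
      rw [hc6]
      exact integrableOn_pow_four_div_add_pow_six hc
    · filter_upwards [ae_restrict_mem measurableSet_Ioi] with k hk
      have hk : 0 < k := hk
      have hexp : Tendsto (fun t : ℝ => Real.exp (-t * k ^ 4)) atTop (nhds 0) :=
        Real.tendsto_exp_atBot.comp
          (tendsto_neg_atTop_atBot.atBot_mul_const (pow_pos hk 4))
      have hbound : Tendsto (fun t : ℝ => 2 / |V₀| * (k * Real.exp (-t * k ^ 4))) atTop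
          (nhds 0) := by
        simpa using (hexp.const_mul k).const_mul (2 / |V₀|)
      simpa using (squeeze_zero_norm (fun t => abs_sq_mul_exp_mul_div_le hV hk)
        hbound).const_add (k ^ 4 / (k ^ 6 + V₀ ^ 2))
  have hmain := hlim.const_mul (-(1 / π))
  rw [hc6, integral_pow_four_div_add_pow_six hc, ← hc6] at hmain
  have hval : -(1 / π) * (π / (3 * c)) = -(1 / (3 * c)) := by
    field_simp
  rw [hval] at hmain
  refine hmain.congr' ?_
  filter_upwards [eventually_ge_atTop 0] with t ht
  exact (intervalIntegral_G₂ hV ht).symm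
end

section
/- Let V₀ < 0 and let β : [0,∞) → ℝ be a bounded measurable function with β(s) → β_∞ as s → ∞. Then the limit as t → ∞ of ∫₀^t G''_{t−s}(V₀(t−s)) β(s) ds equals −β_∞/(3|V₀|^{1/3}). -/
open MeasureTheory Real Filter Set

/-- Laplace transform of the cosine. -/
lemma integral_exp_neg_mul_cos_s4 {a : ℝ} (ha : 0 < a) (b : ℝ) :
    ∫ r in Ioi (0:ℝ), exp (-a * r) * cos (b * r) = a / (a ^ 2 + b ^ 2) := by
  have hne : a ^ 2 + b ^ 2 ≠ 0 := by positivity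
  have hexp : IntegrableOn (fun r : ℝ => exp (-a * r)) (Ioi 0) := integrableOn_exp_mul_Ioi (by linarith) 0
  have hfi : IntegrableOn (fun r : ℝ => exp (-a * r) * cos (b * r)) (Ioi 0) := by
    refine Integrable.mono' hexp (by fun_prop) (ae_of_all _ fun r => ?_)
    rw [norm_mul, norm_of_nonneg (exp_pos _).le]
    exact mul_le_of_le_one_right (exp_pos _).le (abs_cos_le_one _)
  have hderiv : ∀ r ∈ Ici (0:ℝ), HasDerivAt
      (fun r => exp (-a * r) * ((b * sin (b * r) - a * cos (b * r)) / (a ^ 2 + b ^ 2)))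
      (exp (-a * r) * cos (b * r)) r := by
    intro r _
    have h1 : HasDerivAt (fun r : ℝ => -a * r) (-a) r := by
      simpa using (hasDerivAt_id r).const_mul (-a)
    have h2 : HasDerivAt (fun r : ℝ => b * r) b r := by
      simpa using (hasDerivAt_id r).const_mul b
    convert! h1.exp.mul (((h2.sin.const_mul b).sub (h2.cos.const_mul a)).div_const
      (a ^ 2 + b ^ 2)) using 1
    simp only [Pi.sub_apply]
    field_simp
    ring
  have htend : Tendsto
      (fun r => exp (-a * r) * ((b * sin (b * r) - a * cos (b * r)) / (a ^ 2 + b ^ 2)))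
      atTop (nhds 0) := by
    have hlin : Tendsto (fun r : ℝ => -a * r) atTop atBot :=
      tendsto_id.const_mul_atTop_of_neg (by linarith)
    have h0 : Tendsto (fun r : ℝ => exp (-a * r) * ((|b| + a) / (a ^ 2 + b ^ 2))) atTop (nhds 0) := by
      simpa using (tendsto_exp_atBot.comp hlin).mul_const ((|b| + a) / (a ^ 2 + b ^ 2))
    refine squeeze_zero_norm (fun r => ?_) h0
    rw [norm_mul, norm_of_nonneg (exp_pos _).le, norm_div, norm_of_nonneg (by positivity : 0 ≤ a ^ 2 + b ^ 2)]
    gcongr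
    refine (norm_sub_le _ _).trans ?_
    rw [norm_mul, norm_mul, norm_of_nonneg ha.le]
    exact add_le_add (mul_le_of_le_one_right (norm_nonneg _) (abs_sin_le_one _))
      (mul_le_of_le_one_right ha.le (abs_cos_le_one _))
  rw [integral_Ioi_of_hasDerivAt_of_tendsto' hderiv hfi htend]
  simp [neg_div]

lemma integrableOn_pow_mul_exp_neg_mul_pow_four (n : ℕ) {r : ℝ} (hr : 0 < r) :
    IntegrableOn (fun k : ℝ => k ^ n * exp (-r * k ^ 4)) (Ioi 0) := by
  have h := integrableOn_rpow_mul_exp_neg_mul_rpow (p := 4) (s := n) (b := r)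
    (by have : (0:ℝ) ≤ n := n.cast_nonneg
        linarith) (by norm_num) hr
  refine h.congr_fun (fun k _ => ?_) measurableSet_Ioi
  norm_cast

lemma integral_pow_mul_exp_neg_mul_pow_four (n : ℕ) {r : ℝ} (hr : 0 < r) :
    ∫ k in Ioi (0:ℝ), k ^ n * exp (-r * k ^ 4) =
      r ^ (-((n:ℝ) + 1) / 4) * (1 / 4 * Gamma (((n:ℝ) + 1) / 4)) := by
  have h := integral_rpow_mul_exp_neg_mul_rpow (p := 4) (q := n) (b := r) (by norm_num)
    (by have : (0:ℝ) ≤ n := n.cast_nonneg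
        linarith) hr
  rw [← mul_assoc, ← h]
  refine setIntegral_congr_fun measurableSet_Ioi (fun k _ => ?_)
  norm_cast

lemma integral_pow_four_div_pow_six_add_one :
    IntegrableOn (fun k : ℝ => k ^ 4 / (k ^ 6 + 1)) (Ioi 0) ∧
    ∫ k in Ioi (0:ℝ), k ^ 4 / (k ^ 6 + 1) = π / 3 := by
  set s : ℝ := √3 with hs
  have hs2 : s ^ 2 = 3 := sq_sqrt (by norm_num)
  have hp : ∀ k : ℝ, 0 < k ^ 2 + s * k + 1 := fun k => by nlinarith [sq_nonneg (2 * k + s)]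
  have hm : ∀ k : ℝ, 0 < k ^ 2 - s * k + 1 := fun k => by nlinarith [sq_nonneg (2 * k - s)]
  let F : ℝ → ℝ := fun k => 1 / 3 * arctan k + 1 / 6 * (arctan (2 * k + s) + arctan (2 * k - s))
    + s / 12 * log ((k ^ 2 - s * k + 1) / (k ^ 2 + s * k + 1))
  have hderiv : ∀ k ∈ Ici (0:ℝ), HasDerivAt F (k ^ 4 / (k ^ 6 + 1)) k := by
    intro k _
    have h2 : HasDerivAt (fun k : ℝ => 2 * k) 2 k := by
      simpa using (hasDerivAt_id k).const_mul 2
    have hq : HasDerivAt (fun k : ℝ => k ^ 2) (2 * k) k := by simpa using hasDerivAt_pow 2 k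
    have hl : HasDerivAt (fun k : ℝ => s * k) s k := by
      simpa using (hasDerivAt_id k).const_mul s
    convert! (((hasDerivAt_arctan k).const_mul (1 / 3)).add
      ((((h2.add_const s).arctan).add ((h2.sub_const s).arctan)).const_mul (1 / 6))).add
      (((((hq.sub hl).add_const 1).div ((hq.add hl).add_const 1) (hp k).ne').log
        (div_pos (hm k) (hp k)).ne').const_mul (s / 12)) using 1
    simp only [Pi.add_apply, Pi.sub_apply, Pi.div_apply]
    have e1 : 1 + (2 * k + s) ^ 2 = 4 * (k ^ 2 + s * k + 1) := by linear_combination hs2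
    have e2 : 1 + (2 * k - s) ^ 2 = 4 * (k ^ 2 - s * k + 1) := by linear_combination hs2
    have e3 : k ^ 6 + 1 = (k ^ 2 + 1) * ((k ^ 2 + s * k + 1) * (k ^ 2 - s * k + 1)) := by
      linear_combination (k ^ 2 * (k ^ 2 + 1)) * hs2
    rw [e1, e2, e3, add_comm 1 (k ^ 2)]
    have hp0 := (hp k).ne'
    have hm0 := (hm k).ne'
    have hk0 : k ^ 2 + 1 ≠ 0 := by positivity
    obtain ⟨p, hpk⟩ : ∃ p, p = k ^ 2 + s * k + 1 := ⟨_, rfl⟩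
    obtain ⟨m, hmk⟩ : ∃ m, m = k ^ 2 - s * k + 1 := ⟨_, rfl⟩
    obtain ⟨q, hqk⟩ : ∃ q, q = k ^ 2 + 1 := ⟨_, rfl⟩
    rw [← hpk] at hp0 ⊢
    rw [← hmk] at hm0 ⊢
    rw [← hqk] at hk0 ⊢
    field_simp
    rw [hpk, hmk, hqk]
    ring_nf
    simp only [hs2]
    ring
  have hlin : Tendsto (fun k : ℝ => 2 * k) atTop atTop := tendsto_id.const_mul_atTop (by norm_num)
  have hat : Tendsto arctan atTop (nhds (π / 2)) :=
    tendsto_nhds_of_tendsto_nhdsWithin tendsto_arctan_atTop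
  have hfrac : Tendsto (fun k : ℝ => (k ^ 2 - s * k + 1) / (k ^ 2 + s * k + 1)) atTop (nhds 1) := by
    have hinv : Tendsto (fun k : ℝ => k⁻¹) atTop (nhds 0) := tendsto_inv_atTop_zero
    have : Tendsto (fun k : ℝ => (1 - s * k⁻¹ + k⁻¹ ^ 2) / (1 + s * k⁻¹ + k⁻¹ ^ 2)) atTop
        (nhds ((1 - s * 0 + 0 ^ 2) / (1 + s * 0 + 0 ^ 2))) :=
      (((tendsto_const_nhds.sub (hinv.const_mul s)).add (hinv.pow 2))).div
        (((tendsto_const_nhds.add (hinv.const_mul s)).add (hinv.pow 2))) (by norm_num)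
    norm_num at this
    refine this.congr' ?_
    filter_upwards [eventually_gt_atTop 0] with k hk
    have h2 : 1 + s * k⁻¹ + (k ^ 2)⁻¹ ≠ 0 := by positivity
    field_simp
  have htend : Tendsto F atTop (nhds (π / 3)) := by
    have h1 := ((hat.const_mul (1 / 3)).add (((hat.comp
      (tendsto_atTop_add_const_right _ s hlin)).add (hat.comp
      (tendsto_atTop_add_const_right _ (-s) hlin))).const_mul (1 / 6))).add
      ((hfrac.log one_ne_zero).const_mul (s / 12))
    convert! h1 using 2
    rw [log_one]; ring
  have hnn : ∀ k ∈ Ioi (0:ℝ), 0 ≤ k ^ 4 / (k ^ 6 + 1) := fun k _ => by positivity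
  refine ⟨integrableOn_Ioi_deriv_of_nonneg' hderiv hnn htend, ?_⟩
  rw [integral_Ioi_of_hasDerivAt_of_nonneg' hderiv hnn htend]
  simp [F, arctan_neg]

lemma integral_pow_four_div_pow_six_add_sq {V : ℝ} (hV : V ≠ 0) :
    ∫ k in Ioi (0:ℝ), k ^ 4 / (k ^ 6 + V ^ 2) = π / (3 * |V| ^ ((1:ℝ) / 3)) := by
  set a : ℝ := |V| ^ ((1:ℝ) / 3) with ha
  have hapos : 0 < a := rpow_pos_of_pos (abs_pos.2 hV) _
  have ha3 : a ^ 3 = |V| := by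
    rw [ha, ← rpow_natCast, ← rpow_mul (abs_nonneg V)]; norm_num
  have ha6 : V ^ 2 = a ^ 6 := by
    rw [← sq_abs, ← ha3]; ring
  have h := integral_comp_mul_left_Ioi (fun k : ℝ => k ^ 4 / (k ^ 6 + V ^ 2)) 0 hapos
  rw [mul_zero, smul_eq_mul] at h
  have h2 : ∫ k in Ioi (0:ℝ), (a * k) ^ 4 / ((a * k) ^ 6 + V ^ 2) =
      (a ^ 2)⁻¹ * ∫ k in Ioi (0:ℝ), k ^ 4 / (k ^ 6 + 1) := by
    rw [← integral_const_mul]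
    refine setIntegral_congr_fun measurableSet_Ioi (fun k _ => ?_)
    rw [ha6]
    have : a ^ 6 * k ^ 6 + a ^ 6 ≠ 0 := by positivity
    field_simp
  rw [h2, integral_pow_four_div_pow_six_add_one.2] at h
  field_simp at h ⊢
  linarith

lemma abs_G₂_le {r : ℝ} (hr : 0 < r) (x : ℝ) :
    |G₂ r x| ≤ 1 / π * (r ^ (-(3:ℝ) / 4) * (1 / 4 * Gamma (3 / 4))) := by
  have hmom := integral_pow_mul_exp_neg_mul_pow_four 2 hr
  norm_num at hmom
  rw [G₂, abs_mul, abs_neg, abs_of_pos (by positivity : 0 < 1 / π)]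
  gcongr
  rw [show -(3:ℝ) / 4 = -(3 / 4) by norm_num, ← hmom, ← norm_eq_abs]
  have hfi := integrableOn_pow_mul_exp_neg_mul_pow_four 2 hr
  simp only [neg_mul] at hfi ⊢
  refine norm_integral_le_of_norm_le hfi (ae_of_all _ fun k => ?_)
  rw [norm_mul, norm_of_nonneg (by positivity)]
  exact mul_le_of_le_one_right (by positivity) (abs_cos_le_one _)

/-- Integration by parts gains a factor `1 / x` in the kernel `G₂`. -/
lemma exists_abs_G₂_le_div :
    ∃ C, ∀ r x : ℝ, 0 < r → x ≠ 0 → |G₂ r x| ≤ C * (r ^ (-(1:ℝ) / 2) / |x|) := by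
  refine ⟨1 / π * (2 * (1 / 4 * Gamma (1 / 2)) + 4 * (1 / 4 * Gamma (3 / 2))), fun r x hr hx => ?_⟩
  have h1 := integrableOn_pow_mul_exp_neg_mul_pow_four 1 hr
  have h2 := integrableOn_pow_mul_exp_neg_mul_pow_four 2 hr
  have h5 := integrableOn_pow_mul_exp_neg_mul_pow_four 5 hr
  have m1 := integral_pow_mul_exp_neg_mul_pow_four 1 hr
  have m5 := integral_pow_mul_exp_neg_mul_pow_four 5 hr
  have e2 : (((1:ℕ):ℝ) + 1) / 4 = (1:ℝ) / 2 := by norm_num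
  have e3 : (((5:ℕ):ℝ) + 1) / 4 = (3:ℝ) / 2 := by norm_num
  have e4 : -(((5:ℕ):ℝ) + 1) / 4 = -(1:ℝ) / 2 - 1 := by norm_num
  have e5 : -(((1:ℕ):ℝ) + 1) / 4 = -(1:ℝ) / 2 := by norm_num
  rw [e2, e5] at m1
  rw [e3, e4, rpow_sub_one hr.ne'] at m5
  have hB : IntegrableOn (fun k : ℝ => 2 * (k ^ 1 * exp (-r * k ^ 4))
      + 4 * r * (k ^ 5 * exp (-r * k ^ 4))) (Ioi 0) := (h1.const_mul 2).add (h5.const_mul (4 * r))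
  have hBval : ∫ k in Ioi (0:ℝ), (2 * (k ^ 1 * exp (-r * k ^ 4))
      + 4 * r * (k ^ 5 * exp (-r * k ^ 4))) =
      r ^ (-(1:ℝ) / 2) * (2 * (1 / 4 * Gamma (1 / 2)) + 4 * (1 / 4 * Gamma (3 / 2))) := by
    rw [integral_add (h1.const_mul 2) (h5.const_mul (4 * r)), integral_const_mul,
      integral_const_mul, m1, m5]
    field_simp
  let R : ℝ → ℝ := fun k => (2 * (k ^ 1 * exp (-r * k ^ 4))
    - 4 * r * (k ^ 5 * exp (-r * k ^ 4))) * sin (k * x)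
  have hRle : ∀ k ∈ Ioi (0:ℝ), ‖R k‖ ≤ 2 * (k ^ 1 * exp (-r * k ^ 4))
      + 4 * r * (k ^ 5 * exp (-r * k ^ 4)) := by
    intro k hk
    have hk : 0 < k := hk
    rw [norm_mul]
    refine (mul_le_of_le_one_right (norm_nonneg _) (abs_sin_le_one _)).trans ?_
    refine (norm_sub_le _ _).trans ?_
    rw [norm_of_nonneg (by positivity), norm_of_nonneg (by positivity)]
  have hR : IntegrableOn R (Ioi 0) :=
    Integrable.mono' hB (by fun_prop) ((ae_restrict_iff' measurableSet_Ioi).2 (ae_of_all _ hRle))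
  have hRint : ‖∫ k in Ioi (0:ℝ), R k‖ ≤
      r ^ (-(1:ℝ) / 2) * (2 * (1 / 4 * Gamma (1 / 2)) + 4 * (1 / 4 * Gamma (3 / 2))) := by
    rw [← hBval]
    exact norm_integral_le_of_norm_le hB
      ((ae_restrict_iff' measurableSet_Ioi).2 (ae_of_all _ hRle))
  have hcos : IntegrableOn (fun k => k ^ 2 * exp (-r * k ^ 4) * cos (k * x)) (Ioi 0) :=
    Integrable.mono' h2 (by fun_prop) (ae_of_all _ fun k => by
      rw [norm_mul, norm_of_nonneg (by positivity)]
      exact mul_le_of_le_one_right (by positivity) (abs_cos_le_one _))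
  have hsin : IntegrableOn (fun k => k ^ 2 * exp (-r * k ^ 4) * sin (k * x)) (Ioi 0) :=
    Integrable.mono' h2 (by fun_prop) (ae_of_all _ fun k => by
      rw [norm_mul, norm_of_nonneg (by positivity)]
      exact mul_le_of_le_one_right (by positivity) (abs_sin_le_one _))
  have hderiv : ∀ k : ℝ, HasDerivAt (fun k => k ^ 2 * exp (-r * k ^ 4) * sin (k * x))
      (R k + x * (k ^ 2 * exp (-r * k ^ 4) * cos (k * x))) k := by
    intro k
    have d4 : HasDerivAt (fun k : ℝ => -r * k ^ 4) (-r * (4 * k ^ 3)) k := by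
      simpa using (hasDerivAt_pow 4 k).const_mul (-r)
    have d2 : HasDerivAt (fun k : ℝ => k ^ 2) (2 * k) k := by simpa using hasDerivAt_pow 2 k
    have dx : HasDerivAt (fun k : ℝ => k * x) x k := by simpa using (hasDerivAt_id k).mul_const x
    convert! (d2.mul d4.exp).mul dx.sin using 1
    simp only [R, Pi.mul_apply]
    ring
  have hfi' := hR.add (hcos.const_mul x)
  have hlim := tendsto_zero_of_hasDerivAt_of_integrableOn_Ioi (a := 0)
    (fun k _ => hderiv k) hfi' hsin
  have hFTC := integral_Ioi_of_hasDerivAt_of_tendsto' (fun k _ => hderiv k) hfi' hlim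
  rw [integral_add hR (hcos.const_mul x), integral_const_mul] at hFTC
  have hval : ∫ k in Ioi (0:ℝ), k ^ 2 * exp (-r * k ^ 4) * cos (k * x) =
      -(∫ k in Ioi (0:ℝ), R k) / x := by
    rw [eq_div_iff hx]
    simp at hFTC ⊢
    linarith
  rw [G₂, hval, abs_mul, abs_neg, abs_of_pos (by positivity : 0 < 1 / π), abs_div, abs_neg,
    mul_assoc]
  refine mul_le_mul_of_nonneg_left ?_ (by positivity)
  rw [mul_div_assoc', mul_comm _ (r ^ _)]
  gcongr
  exact hRint

lemma measurable_G₂_comp_mul (V : ℝ) : Measurable fun r => G₂ r (V * r) := by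
  refine Measurable.const_mul (StronglyMeasurable.measurable ?_) _
  refine StronglyMeasurable.integral_prod_right
    (f := fun r k : ℝ => k ^ 2 * exp (-r * k ^ 4) * cos (k * (V * r))) ?_
  refine Continuous.stronglyMeasurable ?_
  unfold Function.uncurry
  fun_prop

lemma integrableOn_G₂_comp_mul {V : ℝ} (hV : V ≠ 0) :
    IntegrableOn (fun r => G₂ r (V * r)) (Ioi 0) := by
  obtain ⟨C, hC⟩ := exists_abs_G₂_le_div
  rw [← Ioc_union_Ioi_eq_Ioi (zero_le_one (α := ℝ)), integrableOn_union]
  have hm := (measurable_G₂_comp_mul V).aestronglyMeasurable (μ := volume)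
  constructor
  · have h : IntegrableOn (fun r : ℝ => r ^ (-(3:ℝ) / 4)) (Ioc 0 1) :=
      (intervalIntegrable_iff_integrableOn_Ioc_of_le zero_le_one).1
        (intervalIntegral.intervalIntegrable_rpow' (by norm_num))
    refine Integrable.mono' ((h.mul_const (1 / 4 * Gamma (3 / 4))).const_mul (1 / π)) hm.restrict
      ((ae_restrict_iff' measurableSet_Ioc).2 (ae_of_all _ fun r hr => abs_G₂_le hr.1 _))
  · have h : IntegrableOn (fun r : ℝ => r ^ (-(3:ℝ) / 2)) (Ioi 1) :=
      integrableOn_Ioi_rpow_of_lt (by norm_num) one_pos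
    refine Integrable.mono' (h.const_mul (C / |V|)) hm.restrict
      ((ae_restrict_iff' measurableSet_Ioi).2 (ae_of_all _ fun r hr => ?_))
    have hr0 : 0 < r := one_pos.trans hr
    refine (hC r (V * r) hr0 (mul_ne_zero hV hr0.ne')).trans_eq ?_
    rw [abs_mul, abs_of_pos hr0, show -(3:ℝ) / 2 = -(1:ℝ) / 2 - 1 by norm_num,
      rpow_sub_one hr0.ne']
    field_simp

/-- Laplace transform of `r ↦ G₂ r (V * r)`, by Fubini. -/
lemma integral_exp_neg_mul_G₂_comp_mul (V : ℝ) {ε : ℝ} (hε : 0 < ε) :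
    ∫ r in Ioi (0:ℝ), exp (-ε * r) * G₂ r (V * r) = -(1 / π) * ∫ k in Ioi (0:ℝ),
      k ^ 2 * ((k ^ 4 + ε) / ((k ^ 4 + ε) ^ 2 + (k * V) ^ 2)) := by
  let f : ℝ → ℝ → ℝ := fun r k => exp (-ε * r) * (k ^ 2 * exp (-r * k ^ 4) * cos (k * (V * r)))
  let g : ℝ → ℝ → ℝ := fun r k => exp (-ε * r) * (k ^ 2 * exp (-r * k ^ 4))
  have hg : Integrable (Function.uncurry g)
      ((volume.restrict (Ioi (0:ℝ))).prod (volume.restrict (Ioi (0:ℝ)))) := by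
    rw [integrable_prod_iff (by
      refine Continuous.aestronglyMeasurable ?_
      simp only [g, Function.uncurry_def]
      fun_prop)]
    refine ⟨(ae_restrict_iff' measurableSet_Ioi).2 (ae_of_all _ fun r hr =>
      (integrableOn_pow_mul_exp_neg_mul_pow_four 2 hr).const_mul (exp (-ε * r))), ?_⟩
    have h := integrableOn_rpow_mul_exp_neg_mul_rpow (p := 1) (s := -(3:ℝ) / 4) (b := ε)
      (by norm_num) one_pos hε
    refine IntegrableOn.congr_fun (h.mul_const (1 / 4 * Gamma ((2 + 1) / 4)))
      (fun r hr => ?_) measurableSet_Ioi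
    have : ∀ k, ‖Function.uncurry g (r, k)‖ = exp (-ε * r) * (k ^ 2 * exp (-r * k ^ 4)) :=
      fun k => norm_of_nonneg (by simp only [g, Function.uncurry]; positivity)
    simp only [this]
    rw [integral_const_mul, integral_pow_mul_exp_neg_mul_pow_four 2 hr, rpow_one]
    norm_num
    ring
  have hf : Integrable (Function.uncurry f)
      ((volume.restrict (Ioi (0:ℝ))).prod (volume.restrict (Ioi (0:ℝ)))) := by
    refine hg.mono' (Continuous.aestronglyMeasurable ?_) (ae_of_all _ fun ⟨r, k⟩ => ?_)
    · simp only [f, Function.uncurry_def]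
      fun_prop
    · simp only [f, g, Function.uncurry]
      rw [← mul_assoc, norm_mul, norm_of_nonneg (by positivity)]
      exact mul_le_of_le_one_right (by positivity) (abs_cos_le_one _)
  have hswap := integral_integral_swap hf
  have hL : ∫ r in Ioi (0:ℝ), exp (-ε * r) * G₂ r (V * r) =
      -(1 / π) * ∫ r in Ioi (0:ℝ), ∫ k in Ioi (0:ℝ), f r k := by
    rw [← integral_const_mul]
    refine setIntegral_congr_fun measurableSet_Ioi fun r _ => ?_
    simp only [f, G₂, integral_const_mul]
    ring
  rw [hL, hswap]
  congr 1
  refine setIntegral_congr_fun measurableSet_Ioi fun k _ => ?_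
  rw [← integral_exp_neg_mul_cos_s4 (by positivity : 0 < k ^ 4 + ε) (k * V), ← integral_const_mul]
  refine setIntegral_congr_fun measurableSet_Ioi fun r _ => ?_
  simp only [f]
  rw [show -(k ^ 4 + ε) * r = -ε * r + -r * k ^ 4 by ring, exp_add]
  ring_nf

lemma integral_G₂_comp_mul {V : ℝ} (hV : V ≠ 0) :
    ∫ r in Ioi (0:ℝ), G₂ r (V * r) = -(1 / (3 * |V| ^ ((1:ℝ) / 3))) := by
  have hH := integrableOn_G₂_comp_mul hV
  have hpos : ∀ᶠ ε : ℝ in nhdsWithin 0 (Ioi 0), 0 < ε := eventually_mem_nhdsWithin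
  have hid : Tendsto (fun ε : ℝ => ε) (nhdsWithin 0 (Ioi 0)) (nhds 0) :=
    tendsto_nhdsWithin_of_tendsto_nhds tendsto_id
  have hleft : Tendsto (fun ε : ℝ => ∫ r in Ioi (0:ℝ), exp (-ε * r) * G₂ r (V * r))
      (nhdsWithin 0 (Ioi 0)) (nhds (∫ r in Ioi (0:ℝ), G₂ r (V * r))) := by
    refine tendsto_integral_filter_of_dominated_convergence (fun r => ‖G₂ r (V * r)‖)
      (Eventually.of_forall fun ε => ?_) ?_ hH.norm (ae_of_all _ fun r => ?_)
    · exact ((by fun_prop : Measurable fun r : ℝ => exp (-ε * r)).mul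
        (measurable_G₂_comp_mul V)).aestronglyMeasurable
    · filter_upwards [hpos] with ε hε
      refine (ae_restrict_iff' measurableSet_Ioi).2 (ae_of_all _ fun r hr => ?_)
      rw [norm_mul, norm_of_nonneg (exp_pos _).le]
      refine mul_le_of_le_one_left (norm_nonneg _) (exp_le_one_iff.2 ?_)
      have := mul_pos hε hr
      linarith
    · have : Tendsto (fun ε : ℝ => exp (-ε * r) * G₂ r (V * r)) (nhds 0)
          (nhds (exp (-0 * r) * G₂ r (V * r))) :=
        Continuous.tendsto (by fun_prop) 0
      simpa using this.mono_left nhdsWithin_le_nhds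
  have hright : Tendsto (fun ε : ℝ => ∫ k in Ioi (0:ℝ),
        k ^ 2 * ((k ^ 4 + ε) / ((k ^ 4 + ε) ^ 2 + (k * V) ^ 2)))
      (nhdsWithin 0 (Ioi 0)) (nhds (∫ k in Ioi (0:ℝ), k ^ 4 / (k ^ 6 + V ^ 2))) := by
    refine tendsto_integral_filter_of_dominated_convergence
      ((Ioc (0:ℝ) 1).piecewise (fun k => k / (2 * |V|)) (fun k => k ^ (-2:ℝ)))
      (Eventually.of_forall fun ε => ?_) ?_ ?_ ?_
    · exact Measurable.aestronglyMeasurable (by fun_prop)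
    · filter_upwards [hpos] with ε hε
      refine (ae_restrict_iff' measurableSet_Ioi).2 (ae_of_all _ fun k hk => ?_)
      have hk : 0 < k := hk
      have hV' : 0 < |V| := abs_pos.2 hV
      rw [norm_of_nonneg (by positivity), mul_pow, ← sq_abs V]
      by_cases h : k ∈ Ioc (0:ℝ) 1
      · rw [piecewise_eq_of_mem _ _ _ h, mul_div_assoc', div_le_div_iff₀ (by positivity) (by positivity)]
        nlinarith [mul_nonneg hk.le (sq_nonneg (k ^ 4 + ε - k * |V|))]
      · rw [piecewise_eq_of_notMem _ _ _ h, rpow_neg hk.le, rpow_two, mul_div_assoc', inv_eq_one_div,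
          div_le_div_iff₀ (by positivity) (by positivity)]
        have : 0 ≤ ε * k ^ 4 + ε ^ 2 + k ^ 2 * |V| ^ 2 := by positivity
        nlinarith
    · have hI : IntegrableOn (fun k : ℝ => k / (2 * |V|)) (Ioc 0 1) :=
        (Continuous.integrableOn_Icc (by fun_prop)).mono_set Ioc_subset_Icc_self
      have hJ : IntegrableOn (fun k : ℝ => k ^ (-2:ℝ)) (Ioi 1) :=
        integrableOn_Ioi_rpow_of_lt (by norm_num) one_pos
      rw [← IntegrableOn, ← Ioc_union_Ioi_eq_Ioi (zero_le_one (α := ℝ)), integrableOn_union]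
      refine ⟨hI.congr_fun (fun k hk => ?_) measurableSet_Ioc,
        hJ.congr_fun (fun k hk => ?_) measurableSet_Ioi⟩
      · rw [piecewise_eq_of_mem _ _ _ hk]
      · rw [piecewise_eq_of_notMem _ _ _ fun h => not_le.2 hk h.2]
    · refine (ae_restrict_iff' measurableSet_Ioi).2 (ae_of_all _ fun k hk => ?_)
      have hk : 0 < k := hk
      have hadd : Tendsto (fun ε : ℝ => k ^ 4 + ε) (nhdsWithin 0 (Ioi 0)) (nhds (k ^ 4 + 0)) :=
        tendsto_const_nhds.add hid
      have := (hadd.div ((hadd.pow 2).add_const ((k * V) ^ 2)) (by positivity)).const_mul (k ^ 2)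
      convert! this using 2
      have : k ^ 6 + V ^ 2 ≠ 0 := by positivity
      rw [add_zero, mul_pow, ← pow_mul, mul_div_assoc', div_eq_div_iff this (by positivity)]
      ring
  have heq := tendsto_nhds_unique (hleft.congr' (by
    filter_upwards [hpos] with ε hε using integral_exp_neg_mul_G₂_comp_mul V hε))
    (hright.const_mul (-(1 / π)))
  rw [heq, integral_pow_four_div_pow_six_add_sq hV]
  have : 0 < |V| ^ ((1:ℝ) / 3) := rpow_pos_of_pos (abs_pos.2 hV) _
  field_simp

/-- Convolving an integrable kernel with a bounded convergent function. -/
lemma tendsto_intervalIntegral_conv {h β : ℝ → ℝ} {b C : ℝ} (hh : IntegrableOn h (Ioi 0))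
    (hmeas : Measurable β) (hbdd : ∀ s ∈ Ici (0:ℝ), |β s| ≤ C)
    (hlim : Tendsto β atTop (nhds b)) :
    Tendsto (fun t : ℝ => ∫ s in (0:ℝ)..t, h (t - s) * β s) atTop
      (nhds ((∫ r in Ioi (0:ℝ), h r) * b)) := by
  rw [← integral_mul_const]
  have hDCT : Tendsto (fun t : ℝ => ∫ r in Ioi (0:ℝ), h r * (Iic t).indicator (fun r => β (t - r)) r)
      atTop (nhds (∫ r in Ioi (0:ℝ), h r * b)) := by
    refine tendsto_integral_filter_of_dominated_convergence (fun r => ‖h r‖ * C)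
      (Eventually.of_forall fun t => ?_) (Eventually.of_forall fun t => ae_of_all _ fun r => ?_)
      (hh.norm.mul_const C) (ae_of_all _ fun r => ?_)
    · exact hh.aestronglyMeasurable.mul ((hmeas.comp (measurable_const.sub measurable_id)).indicator
        measurableSet_Iic).aestronglyMeasurable
    · rw [norm_mul]
      refine mul_le_mul_of_nonneg_left ?_ (norm_nonneg _)
      by_cases hr : r ∈ Iic t
      · rw [indicator_of_mem hr]
        exact hbdd _ (sub_nonneg.2 (mem_Iic.1 hr))
      · rw [indicator_of_notMem hr, norm_zero]
        exact (abs_nonneg _).trans (hbdd 0 self_mem_Ici)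
    · refine Tendsto.const_mul _ (Tendsto.congr' ?_
        (hlim.comp (tendsto_atTop_add_const_right atTop (-r) tendsto_id)))
      filter_upwards [eventually_ge_atTop r] with t ht
      rw [indicator_of_mem (by exact ht)]
      rfl
  refine hDCT.congr' ?_
  filter_upwards [eventually_ge_atTop 0] with t ht
  have hsub := intervalIntegral.integral_comp_sub_left (a := 0) (b := t)
    (fun r => h r * β (t - r)) t
  simp only [sub_sub_cancel, sub_self, sub_zero] at hsub
  rw [hsub, intervalIntegral.integral_of_le ht]
  have hind : (fun r => h r * (Iic t).indicator (fun r => β (t - r)) r) =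
      (Iic t).indicator (fun r => h r * β (t - r)) := by
    ext r
    by_cases hr : r ∈ Iic t <;> simp [hr, indicator]
  rw [hind, setIntegral_indicator measurableSet_Iic, Ioi_inter_Iic]

/-- For `V₀ < 0` and a bounded measurable `β` on `[0,∞)` with
`β(s) → β_∞` as `s → ∞`, `∫₀^t G''_{t−s}(V₀(t−s)) β(s) ds → −β_∞/(3|V₀|^{1/3})`. -/
theorem stmt4 (V₀ : ℝ) (hV₀ : V₀ < 0) (β : ℝ → ℝ) (β_inf : ℝ)
    (hmeas : Measurable β) (hbdd : ∃ C : ℝ, ∀ s ∈ Set.Ici (0:ℝ), |β s| ≤ C)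
    (hlim : Tendsto β atTop (nhds β_inf)) :
    Tendsto (fun t : ℝ => ∫ s in (0:ℝ)..t, G₂ (t - s) (V₀ * (t - s)) * β s) atTop
      (nhds (-(β_inf / (3 * |V₀| ^ ((1:ℝ)/3))))) := by
  obtain ⟨C, hC⟩ := hbdd
  have h := tendsto_intervalIntegral_conv (integrableOn_G₂_comp_mul hV₀.ne) hmeas hC hlim
  rw [integral_G₂_comp_mul hV₀.ne, neg_mul, one_div_mul_eq_div] at h
  exact h
end

section
/- The self-similar profile g is smooth, even, and satisfies the ordinary differential equation 4 g''''(z) = g(z) + z g'(z) for all z ∈ ℝ, with initial values g(0) = Γ(1/4)/(4π), g'(0) = 0, g''(0) = −Γ(3/4)/(4π), g'''(0) = 0. -/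
open MeasureTheory Real Filter Set

/-- The `n`-th moment integrand `kⁿ e^{−k⁴} cos(kz + nπ/2)`, which is the `n`-th derivative in `z`
of `e^{−k⁴} cos(kz)`. -/
noncomputable def quarticIntegrand (n : ℕ) (z k : ℝ) : ℝ :=
  k ^ n * Real.exp (-k ^ 4) * Real.cos (k * z + n * (π / 2))

theorem continuous_quarticIntegrand (n : ℕ) (z : ℝ) : Continuous (quarticIntegrand n z) := by
  unfold quarticIntegrand
  fun_prop

theorem integrableOn_pow_mul_exp_neg_pow_four (n : ℕ) :
    IntegrableOn (fun k : ℝ => k ^ n * Real.exp (-k ^ 4)) (Ioi 0) := by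
  have h := integrableOn_rpow_mul_exp_neg_rpow (p := 4) (s := n)
    (by linarith [n.cast_nonneg (α := ℝ)]) (by norm_num)
  exact_mod_cast h

theorem integral_pow_mul_exp_neg_pow_four (n : ℕ) :
    ∫ k in Ioi (0 : ℝ), k ^ n * Real.exp (-k ^ 4) = 1 / 4 * Real.Gamma ((n + 1) / 4) := by
  have h := integral_rpow_mul_exp_neg_rpow (p := 4) (q := n)
    (by norm_num) (by linarith [n.cast_nonneg (α := ℝ)])
  exact_mod_cast h

theorem norm_quarticIntegrand_le (n : ℕ) (z : ℝ) {k : ℝ} (hk : 0 < k) :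
    ‖quarticIntegrand n z k‖ ≤ k ^ n * Real.exp (-k ^ 4) := by
  have h : 0 ≤ k ^ n * Real.exp (-k ^ 4) := by positivity
  rw [quarticIntegrand, norm_mul, Real.norm_of_nonneg h]
  exact mul_le_of_le_one_right h (Real.abs_cos_le_one _)

theorem integrableOn_quarticIntegrand (n : ℕ) (z : ℝ) :
    IntegrableOn (quarticIntegrand n z) (Ioi 0) :=
  (integrableOn_pow_mul_exp_neg_pow_four n).mono'
    (continuous_quarticIntegrand n z).aestronglyMeasurable
    ((ae_restrict_iff' measurableSet_Ioi).2 (ae_of_all _ fun _ hk =>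
      norm_quarticIntegrand_le n z hk))

theorem hasDerivAt_quarticIntegrand (n : ℕ) (z k : ℝ) :
    HasDerivAt (fun z => quarticIntegrand n z k) (quarticIntegrand (n + 1) z k) z := by
  unfold quarticIntegrand
  have h := ((((hasDerivAt_id z).const_mul k).add_const (n * (π / 2))).cos).const_mul
    (k ^ n * Real.exp (-k ^ 4))
  refine h.congr_deriv ?_
  have e : k * z + ((n + 1 : ℕ) : ℝ) * (π / 2) = k * z + n * (π / 2) + π / 2 := by
    push_cast; ring
  rw [e, Real.cos_add_pi_div_two]
  simp only [id]
  ring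

theorem hasDerivAt_integral_quarticIntegrand (n : ℕ) (z : ℝ) :
    HasDerivAt (fun z => ∫ k in Ioi 0, quarticIntegrand n z k)
      (∫ k in Ioi 0, quarticIntegrand (n + 1) z k) z :=
  (hasDerivAt_integral_of_dominated_loc_of_deriv_le (s := univ) univ_mem
    (Eventually.of_forall fun z => (continuous_quarticIntegrand n z).aestronglyMeasurable)
    (integrableOn_quarticIntegrand n z)
    (continuous_quarticIntegrand (n + 1) z).aestronglyMeasurable
    ((ae_restrict_iff' measurableSet_Ioi).2 (ae_of_all _ fun _ hk z _ =>
      norm_quarticIntegrand_le (n + 1) z hk))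
    (integrableOn_pow_mul_exp_neg_pow_four (n + 1))
    (ae_of_all _ fun k z _ => hasDerivAt_quarticIntegrand n z k)).2

theorem iteratedDeriv_gprof (n : ℕ) :
    iteratedDeriv n gprof = fun z => 1 / π * ∫ k in Ioi 0, quarticIntegrand n z k := by
  induction n with
  | zero =>
    ext z
    simp [gprof, quarticIntegrand]
  | succ n ih =>
    rw [iteratedDeriv_succ, ih]
    ext z
    exact ((hasDerivAt_integral_quarticIntegrand n z).const_mul (1 / π)).deriv

theorem contDiff_gprof : ContDiff ℝ (⊤ : ℕ∞) gprof := by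
  refine contDiff_of_differentiable_iteratedDeriv fun n _ z => ?_
  rw [iteratedDeriv_gprof]
  exact ((hasDerivAt_integral_quarticIntegrand n z).const_mul (1 / π)).differentiableAt

theorem hasDerivAt_mul_exp_neg_pow_four_mul_cos (z k : ℝ) :
    HasDerivAt (fun k => k * Real.exp (-k ^ 4) * Real.cos (k * z))
      (quarticIntegrand 0 z k + z * quarticIntegrand 1 z k - 4 * quarticIntegrand 4 z k) k := by
  have h := ((hasDerivAt_id k).mul ((hasDerivAt_pow 4 k).neg.exp)).mul
    (((hasDerivAt_id k).mul_const z).cos)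
  refine h.congr_deriv ?_
  have e : k * z + ((4 : ℕ) : ℝ) * (π / 2) = k * z + 2 * π := by push_cast; ring
  simp only [quarticIntegrand, e, Real.cos_add_two_pi]
  simp [Real.cos_add_pi_div_two]
  ring

theorem integral_quarticIntegrand_four (z : ℝ) :
    4 * ∫ k in Ioi 0, quarticIntegrand 4 z k =
      (∫ k in Ioi 0, quarticIntegrand 0 z k) + z * ∫ k in Ioi 0, quarticIntegrand 1 z k := by
  have h₀ := integrableOn_quarticIntegrand 0 z
  have h₁ := (integrableOn_quarticIntegrand 1 z).const_mul z
  have h₄ := (integrableOn_quarticIntegrand 4 z).const_mul 4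
  have hd := fun k (_ : k ∈ Ioi (0 : ℝ)) => hasDerivAt_mul_exp_neg_pow_four_mul_cos z k
  have hf : IntegrableOn (fun k => k * Real.exp (-k ^ 4) * Real.cos (k * z)) (Ioi 0) := by
    refine (integrableOn_pow_mul_exp_neg_pow_four 1).mono'
      (Continuous.aestronglyMeasurable (by fun_prop))
      ((ae_restrict_iff' measurableSet_Ioi).2 (ae_of_all _ fun k (hk : 0 < k) => ?_))
    have h : 0 ≤ k * Real.exp (-k ^ 4) := by positivity
    rw [norm_mul, Real.norm_of_nonneg h, pow_one]
    exact mul_le_of_le_one_right h (Real.abs_cos_le_one _)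
  have hI := integral_Ioi_of_hasDerivAt_of_tendsto
    (hasDerivAt_mul_exp_neg_pow_four_mul_cos z 0).continuousAt.continuousWithinAt hd
    ((h₀.add h₁).sub h₄)
    (tendsto_zero_of_hasDerivAt_of_integrableOn_Ioi hd ((h₀.add h₁).sub h₄) hf)
  have hs := integral_sub (h₀.add h₁) h₄
  have ha := integral_add h₀ h₁
  simp only [Pi.add_apply, integral_const_mul] at hs ha
  simp only [zero_mul, sub_zero] at hI
  linarith

/-- The self-similar profile `g` is smooth, even, satisfies
`4 g''''(z) = g(z) + z g'(z)`, with
`g(0) = Γ(1/4)/(4π)`, `g'(0) = 0`, `g''(0) = −Γ(3/4)/(4π)`, `g'''(0) = 0`. -/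
theorem stmt11 :
    ContDiff ℝ (⊤ : ℕ∞) gprof ∧
    (∀ z : ℝ, gprof (-z) = gprof z) ∧
    (∀ z : ℝ, 4 * iteratedDeriv 4 gprof z = gprof z + z * deriv gprof z) ∧
    gprof 0 = Real.Gamma (1/4) / (4 * Real.pi) ∧
    deriv gprof 0 = 0 ∧
    iteratedDeriv 2 gprof 0 = -(Real.Gamma (3/4) / (4 * Real.pi)) ∧
    iteratedDeriv 3 gprof 0 = 0 := by
  refine ⟨contDiff_gprof, fun z => by simp [gprof], fun z => ?_, ?_, ?_, ?_, ?_⟩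
  · rw [← iteratedDeriv_one, ← congrFun (iteratedDeriv_zero (f := gprof)) z]
    simp only [iteratedDeriv_gprof]
    linear_combination 1 / π * integral_quarticIntegrand_four z
  · have h := integral_pow_mul_exp_neg_pow_four 0
    simp only [pow_zero, one_mul, Nat.cast_zero, zero_add] at h
    simp only [gprof, mul_zero, Real.cos_zero, mul_one, h]
    field_simp
  · rw [← iteratedDeriv_one, iteratedDeriv_gprof]
    simp [quarticIntegrand]
  · have h := integral_pow_mul_exp_neg_pow_four 2
    have e : ((2 : ℕ) : ℝ) * (π / 2) = π := by push_cast; ring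
    rw [show (((2 : ℕ) : ℝ) + 1) / 4 = 3 / 4 by norm_num] at h
    simp only [iteratedDeriv_gprof, quarticIntegrand, mul_zero, zero_add, e, Real.cos_pi, mul_neg,
      mul_one, integral_neg, h]
    field_simp
  · have e : ((3 : ℕ) : ℝ) * (π / 2) = π / 2 + π := by push_cast; ring
    simp only [iteratedDeriv_gprof, quarticIntegrand, zero_add, e, Real.cos_add_pi,
      Real.cos_pi_div_two, neg_zero, mul_zero, integral_zero]
end

section
/- The second moment of the self-similar profile vanishes: ∫₀^∞ z² g(z) dz = 0. -/
open MeasureTheory Real Filter Set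

open Polynomial in
/-- Polynomial multiples of `e^{-x⁴}` are bounded. -/
lemma exists_bound_eval_mul_exp_neg_pow_four (P : ℝ[X]) :
    ∃ C, ∀ x : ℝ, |P.eval x| * Real.exp (-x ^ 4) ≤ C := by
  induction P using Polynomial.induction_on' with
  | add p q hp hq =>
    obtain ⟨C, hC⟩ := hp
    obtain ⟨D, hD⟩ := hq
    refine ⟨C + D, fun x ↦ ?_⟩
    rw [eval_add]
    calc |p.eval x + q.eval x| * Real.exp (-x ^ 4)
        ≤ (|p.eval x| + |q.eval x|) * Real.exp (-x ^ 4) := by gcongr; exact abs_add_le _ _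
      _ ≤ C + D := by rw [add_mul]; exact add_le_add (hC x) (hD x)
  | monomial n a =>
    refine ⟨|a| * (1 + n.factorial), fun x ↦ ?_⟩
    have hexp : Real.exp (-x ^ 4) ≤ 1 := by
      rw [Real.exp_le_one_iff]; nlinarith [sq_nonneg (x ^ 2)]
    have hfac : (x ^ 4) ^ n * Real.exp (-x ^ 4) ≤ n.factorial := by
      have h := Real.pow_div_factorial_le_exp (x ^ 4) (by positivity) n
      rw [Real.exp_neg, ← div_eq_mul_inv, div_le_iff₀ (Real.exp_pos _), mul_comm]
      rwa [div_le_iff₀ (by positivity)] at h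
    have hpow : |x| ^ n ≤ 1 + (x ^ 4) ^ n := by
      rcases le_total |x| 1 with h | h
      · have : |x| ^ n ≤ 1 := pow_le_one₀ (abs_nonneg x) h
        have : 0 ≤ (x ^ 4) ^ n := by positivity
        linarith
      · have : |x| ≤ x ^ 4 := by
          rw [← Even.pow_abs (by decide : Even 4)]
          exact le_self_pow₀ h (by norm_num)
        have := pow_le_pow_left₀ (abs_nonneg x) this n
        linarith
    rw [eval_monomial, abs_mul, abs_pow, mul_assoc]
    gcongr
    calc |x| ^ n * Real.exp (-x ^ 4) ≤ (1 + (x ^ 4) ^ n) * Real.exp (-x ^ 4) := by gcongr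
      _ ≤ 1 + n.factorial := by rw [add_mul, one_mul]; exact add_le_add hexp hfac

open Polynomial in
lemma hasDerivAt_eval_mul_exp_neg_pow_four (P : ℝ[X]) (x : ℝ) :
    HasDerivAt (fun y : ℝ ↦ ((P.eval y * Real.exp (-y ^ 4) : ℝ) : ℂ))
      (((derivative P - 4 * X ^ 3 * P).eval x * Real.exp (-x ^ 4) : ℝ) : ℂ) x := by
  refine HasDerivAt.ofReal_comp ?_
  convert! (P.hasDerivAt x).mul ((hasDerivAt_pow 4 x).neg.exp) using 1
  simp
  ring

open Polynomial in
lemma exists_iteratedDeriv_exp_neg_pow_four (n : ℕ) :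
    ∃ P : ℝ[X], iteratedDeriv n (fun x : ℝ ↦ ((Real.exp (-x ^ 4) : ℝ) : ℂ)) =
      fun x ↦ ((P.eval x * Real.exp (-x ^ 4) : ℝ) : ℂ) := by
  induction n with
  | zero => exact ⟨1, by simp⟩
  | succ n ih =>
    obtain ⟨P, hP⟩ := ih
    refine ⟨derivative P - 4 * X ^ 3 * P, ?_⟩
    rw [iteratedDeriv_succ, hP]
    exact funext fun x ↦ (hasDerivAt_eval_mul_exp_neg_pow_four P x).deriv

open Polynomial in
/-- The function `x ↦ e^{-x⁴}` as a Schwartz function. -/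
noncomputable def quarticExpSchwartz : SchwartzMap ℝ ℂ where
  toFun x := ((Real.exp (-x ^ 4) : ℝ) : ℂ)
  smooth' := Complex.ofRealCLM.contDiff.comp
    (f := fun x : ℝ ↦ Real.exp (-x ^ 4)) (by fun_prop)
  decay' k n := by
    obtain ⟨P, hP⟩ := exists_iteratedDeriv_exp_neg_pow_four n
    obtain ⟨C, hC⟩ := exists_bound_eval_mul_exp_neg_pow_four (X ^ k * P)
    refine ⟨C, fun x ↦ ?_⟩
    rw [norm_iteratedFDeriv_eq_norm_iteratedDeriv, hP, Complex.norm_real, norm_mul,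
      Real.norm_eq_abs, Real.norm_eq_abs, Real.norm_eq_abs, Real.abs_exp]
    simpa [abs_mul, mul_assoc] using hC x

lemma quarticExpSchwartz_apply (x : ℝ) :
    quarticExpSchwartz x = ((Real.exp (-x ^ 4) : ℝ) : ℂ) := rfl

/-- The second derivative of `e^{-x⁴}` vanishes at the origin. -/
lemma deriv_deriv_quarticExpSchwartz_zero :
    deriv (deriv quarticExpSchwartz) 0 = 0 := by
  have h₁ : deriv quarticExpSchwartz =
      fun x ↦ (((-4 * Polynomial.X ^ 3 : Polynomial ℝ).eval x * Real.exp (-x ^ 4) : ℝ) : ℂ) := by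
    funext x
    have h := (hasDerivAt_eval_mul_exp_neg_pow_four 1 x).deriv
    simp only [Polynomial.eval_one, one_mul] at h
    refine Eq.trans h ?_
    simp
  rw [h₁, (hasDerivAt_eval_mul_exp_neg_pow_four _ 0).deriv]
  simp

open FourierTransform in
lemma re_fourier_quarticExpSchwartz (x : ℝ) :
    (𝓕 (quarticExpSchwartz : ℝ → ℂ) x).re = 2 * π * gprof (2 * π * x) := by
  have hint : Integrable fun v : ℝ ↦ 𝐞 (-(v * x)) • quarticExpSchwartz v := by
    convert! (Real.fourierIntegral_convergent_iff' (μ := volume) (innerSL ℝ) x).2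
      quarticExpSchwartz.integrable using 5
    simp [innerSL_apply_apply ℝ, mul_comm]
  have hre (v : ℝ) : (𝐞 (-(v * x)) • quarticExpSchwartz v).re =
      Real.exp (-|v| ^ 4) * Real.cos (|v| * (2 * π * x)) := by
    rw [Even.pow_abs (by decide : Even 4), quarticExpSchwartz_apply, Circle.smul_def,
      Real.fourierChar_apply, smul_eq_mul, Complex.re_mul_ofReal, Complex.exp_ofReal_mul_I_re,
      mul_comm]
    congr 1
    rcases abs_choice v with h | h <;> rw [h]
    · rw [← Real.cos_neg]
      ring_nf
    · ring_nf
  rw [Real.fourier_real_eq, ← RCLike.re_eq_complex_re, ← integral_re hint]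
  simp only [RCLike.re_eq_complex_re, hre]
  rw [integral_comp_abs (f := fun v ↦ Real.exp (-v ^ 4) * Real.cos (v * (2 * π * x))), gprof, ← mul_assoc]
  congr 1
  field_simp

lemma gprof_abs (z : ℝ) : gprof |z| = gprof z := by
  rcases abs_choice z with h | h <;> simp [h, gprof]

/-- `∫₀^∞ z² g(z) dz = 0`. -/
theorem stmt13 : (∫ z in Set.Ioi (0:ℝ), z ^ 2 * gprof z) = 0 := by
  let D := SchwartzMap.derivCLM ℝ ℂ (SchwartzMap.derivCLM ℝ ℂ quarticExpSchwartz)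
  have hD : (D : ℝ → ℂ) = deriv (deriv quarticExpSchwartz) := rfl
  have hfourier (x : ℝ) : FourierTransform.fourier (D : ℝ → ℂ) x =
      (((-(2 * π * x) ^ 2 : ℝ)) : ℂ) * FourierTransform.fourier (quarticExpSchwartz : ℝ → ℂ) x := by
    have h := Real.fourier_deriv
      (SchwartzMap.integrable (SchwartzMap.derivCLM ℝ ℂ quarticExpSchwartz))
      (SchwartzMap.differentiable (SchwartzMap.derivCLM ℝ ℂ quarticExpSchwartz)) D.integrable
    rw [hD, show deriv (deriv quarticExpSchwartz) =
      deriv (SchwartzMap.derivCLM ℝ ℂ quarticExpSchwartz) from rfl, h,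
      show (SchwartzMap.derivCLM ℝ ℂ quarticExpSchwartz : ℝ → ℂ) = deriv quarticExpSchwartz from rfl,
      Real.fourier_deriv quarticExpSchwartz.integrable quarticExpSchwartz.differentiable
      (SchwartzMap.integrable (SchwartzMap.derivCLM ℝ ℂ quarticExpSchwartz))]
    simp only [smul_eq_mul]
    push_cast
    linear_combination (2 * π * x) ^ 2 * FourierTransform.fourier (quarticExpSchwartz : ℝ → ℂ) x *
      Complex.I_sq
  have hint : Integrable (FourierTransform.fourier (D : ℝ → ℂ)) :=
    (FourierTransform.fourier D).integrable
  have hzero : ∫ x, FourierTransform.fourier (D : ℝ → ℂ) x = 0 := by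
    have h := congrFun (D.continuous.fourierInv_fourier_eq D.integrable hint) 0
    rw [Real.fourierInv_eq] at h
    simpa [hD, deriv_deriv_quarticExpSchwartz_zero] using h
  have hre : ∫ x : ℝ, (2 * π * x) ^ 2 * gprof (2 * π * x) = 0 := by
    have h := integral_re hint
    rw [hzero] at h
    simp only [RCLike.re_eq_complex_re, hfourier, Complex.re_ofReal_mul,
      re_fourier_quarticExpSchwartz, Complex.zero_re] at h
    have hπ : -(2 * π) ≠ 0 := neg_ne_zero.2 (by positivity)
    refine (mul_eq_zero.1 (?_ : -(2 * π) * _ = 0)).resolve_left hπ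
    rw [← integral_const_mul, ← h]
    congr 1 with x
    ring
  rw [Measure.integral_comp_mul_left (fun z ↦ z ^ 2 * gprof z)] at hre
  have habs : ∫ z : ℝ, z ^ 2 * gprof z = 2 * ∫ z in Set.Ioi (0 : ℝ), z ^ 2 * gprof z := by
    rw [← integral_comp_abs (f := fun z ↦ z ^ 2 * gprof z)]
    simp [gprof_abs]
  rw [habs] at hre
  simpa [Real.pi_ne_zero] using hre
end

section
/- The third moment of the self-similar profile satisfies ∫₀^∞ z³ g(z) dz = −8 g(0) = −2Γ(1/4)/π. -/
open MeasureTheory Real Filter Set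

/-- The `n`-th derivative of the full-line cosine transform of `e^{−k⁴}`:
`∫ kⁿ e^{−k⁴} cos(kz + nπ/2) dk`. -/
noncomputable def quarticTransform (n : ℕ) (z : ℝ) : ℝ :=
  ∫ k : ℝ, k ^ n * Real.exp (-k ^ 4) * Real.cos (k * z + n * (Real.pi / 2))

lemma integrable_pow_mul_exp_neg_pow_four (n : ℕ) :
    Integrable (fun k : ℝ => k ^ n * Real.exp (-k ^ 4)) := by
  have h := (integrable_rpow_mul_exp_neg_mul_sq (b := 1) one_pos (s := n)
    (by have : (0 : ℝ) ≤ n := n.cast_nonneg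
        linarith)).norm.const_mul (Real.exp 1)
  refine h.mono' (by fun_prop) (Eventually.of_forall fun k => ?_)
  simp only [norm_mul, Real.rpow_natCast, Real.norm_eq_abs, Real.abs_exp]
  rw [mul_left_comm, ← Real.exp_add]
  gcongr
  nlinarith [sq_nonneg (k ^ 2 - 1), sq_nonneg k]

lemma integrable_pow_mul_exp_mul_of_bounded (n : ℕ) {f : ℝ → ℝ} (hf : Continuous f)
    (hb : ∀ k, |f k| ≤ 1) :
    Integrable (fun k : ℝ => k ^ n * Real.exp (-k ^ 4) * f k) := by
  refine (integrable_pow_mul_exp_neg_pow_four n).norm.mono' (by fun_prop)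
    (Eventually.of_forall fun k => ?_)
  rw [norm_mul]
  exact mul_le_of_le_one_right (norm_nonneg _) (hb k)

lemma hasDerivAt_quarticTransform (n : ℕ) (z : ℝ) :
    HasDerivAt (quarticTransform n) (quarticTransform (n + 1) z) z := by
  have hcos : ∀ (m : ℕ) (x : ℝ), Integrable (fun k : ℝ =>
      k ^ m * Real.exp (-k ^ 4) * Real.cos (k * x + m * (Real.pi / 2))) := fun m x =>
    integrable_pow_mul_exp_mul_of_bounded m (by fun_prop) fun k => Real.abs_cos_le_one _
  refine (hasDerivAt_integral_of_dominated_loc_of_deriv_le (μ := volume) (s := univ)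
    (F := fun x k => k ^ n * Real.exp (-k ^ 4) * Real.cos (k * x + n * (Real.pi / 2)))
    (F' := fun x k => k ^ (n + 1) * Real.exp (-k ^ 4) *
      Real.cos (k * x + (n + 1 : ℕ) * (Real.pi / 2)))
    (bound := fun k => ‖k ^ (n + 1) * Real.exp (-k ^ 4)‖) univ_mem
    (Eventually.of_forall fun x => (hcos n x).aestronglyMeasurable) (hcos n z)
    (hcos (n + 1) z).aestronglyMeasurable (Eventually.of_forall fun k x _ => ?_)
    (integrable_pow_mul_exp_neg_pow_four (n + 1)).norm
    (Eventually.of_forall fun k x _ => ?_)).2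
  · rw [norm_mul]
    exact mul_le_of_le_one_right (norm_nonneg _) (Real.abs_cos_le_one _)
  · have h := ((((hasDerivAt_id x).const_mul k).add_const (n * (Real.pi / 2))).cos).const_mul
      (k ^ n * Real.exp (-k ^ 4))
    refine h.congr_deriv ?_
    rw [show k * x + ((n + 1 : ℕ) : ℝ) * (Real.pi / 2)
      = (k * x + n * (Real.pi / 2)) + Real.pi / 2 by push_cast; ring, Real.cos_add_pi_div_two]
    simp only [id]
    ring

lemma mul_quarticTransform (n : ℕ) (z : ℝ) :
    z * quarticTransform n z = 4 * quarticTransform (n + 3) z - n * quarticTransform (n - 1) z := by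
  have hsin : ∀ m : ℕ, Integrable (fun k : ℝ =>
      k ^ m * Real.exp (-k ^ 4) * Real.sin (k * z + n * (Real.pi / 2))) := fun m =>
    integrable_pow_mul_exp_mul_of_bounded m (by fun_prop) fun k => Real.abs_sin_le_one _
  have hcos : Integrable (fun k : ℝ =>
      k ^ n * Real.exp (-k ^ 4) * Real.cos (k * z + n * (Real.pi / 2))) :=
    integrable_pow_mul_exp_mul_of_bounded n (by fun_prop) fun k => Real.abs_cos_le_one _
  have hu : ∀ k : ℝ, HasDerivAt (fun k : ℝ => k ^ n * Real.exp (-k ^ 4))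
      (n * (k ^ (n - 1) * Real.exp (-k ^ 4)) - 4 * (k ^ (n + 3) * Real.exp (-k ^ 4))) k := by
    intro k
    refine ((hasDerivAt_pow n k).mul (hasDerivAt_pow 4 k).fun_neg.exp).congr_deriv ?_
    push_cast
    ring
  have hv : ∀ k : ℝ, HasDerivAt (fun k : ℝ => Real.sin (k * z + n * (Real.pi / 2)))
      (Real.cos (k * z + n * (Real.pi / 2)) * z) k := by
    intro k
    simpa using ((((hasDerivAt_id k).mul_const z).add_const (n * (Real.pi / 2))).sin)
  have hparts := integral_mul_deriv_eq_deriv_mul_of_integrable (fun k _ => hu k) (fun k _ => hv k)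
    (by
      refine (hcos.mul_const z).congr (Eventually.of_forall fun k => ?_)
      simp only [Pi.mul_apply]
      ring)
    (by
      refine (((hsin (n - 1)).const_mul n).sub ((hsin (n + 3)).const_mul 4)).congr
        (Eventually.of_forall fun k => ?_)
      simp only [Pi.mul_apply, Pi.sub_apply]
      ring)
    (hsin n)
  have hleft : z * quarticTransform n z = ∫ k : ℝ, k ^ n * Real.exp (-k ^ 4) *
      (Real.cos (k * z + n * (Real.pi / 2)) * z) := by
    rw [quarticTransform, ← integral_const_mul]
    congr 1 with k
    ring
  have hright : ∫ k : ℝ, (n * (k ^ (n - 1) * Real.exp (-k ^ 4))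
        - 4 * (k ^ (n + 3) * Real.exp (-k ^ 4))) * Real.sin (k * z + n * (Real.pi / 2))
      = n * (∫ k : ℝ, k ^ (n - 1) * Real.exp (-k ^ 4) * Real.sin (k * z + n * (Real.pi / 2)))
        - 4 * ∫ k : ℝ, k ^ (n + 3) * Real.exp (-k ^ 4) * Real.sin (k * z + n * (Real.pi / 2)) := by
    rw [← integral_const_mul, ← integral_const_mul,
      ← integral_sub ((hsin _).const_mul _) ((hsin _).const_mul _)]
    congr 1 with k
    ring
  have hup : ∀ k : ℝ, Real.sin (k * z + n * (Real.pi / 2))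
      = Real.cos (k * z + (n + 3 : ℕ) * (Real.pi / 2)) := by
    intro k
    rw [show k * z + ((n + 3 : ℕ) : ℝ) * (Real.pi / 2)
      = (k * z + n * (Real.pi / 2) + Real.pi) + Real.pi / 2 by push_cast; ring,
      Real.cos_add_pi_div_two, Real.sin_add_pi, neg_neg]
  have hdown : (n : ℝ) *
        (∫ k : ℝ, k ^ (n - 1) * Real.exp (-k ^ 4) * Real.sin (k * z + n * (Real.pi / 2)))
      = n * quarticTransform (n - 1) z := by
    rcases n with _ | m
    · simp
    · congr 1
      refine integral_congr_ae (Eventually.of_forall fun k => ?_)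
      simp only [Nat.add_sub_cancel]
      rw [show k * z + ((m + 1 : ℕ) : ℝ) * (Real.pi / 2)
        = (k * z + m * (Real.pi / 2)) + Real.pi / 2 by push_cast; ring, Real.sin_add_pi_div_two]
  rw [hleft, hparts, hright, hdown]
  simp_rw [hup]
  rw [← quarticTransform]
  ring

lemma exists_bound_pow_mul_quarticTransform (m n : ℕ) :
    ∃ C, ∀ z, |z ^ m * quarticTransform n z| ≤ C := by
  induction m generalizing n with
  | zero =>
    refine ⟨∫ k : ℝ, ‖k ^ n * Real.exp (-k ^ 4)‖, fun z => ?_⟩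
    rw [pow_zero, one_mul, ← Real.norm_eq_abs]
    refine norm_integral_le_of_norm_le (integrable_pow_mul_exp_neg_pow_four n).norm
      (Eventually.of_forall fun k => ?_)
    rw [norm_mul]
    exact mul_le_of_le_one_right (norm_nonneg _) (Real.abs_cos_le_one _)
  | succ m ih =>
    obtain ⟨A, hA⟩ := ih (n + 3)
    obtain ⟨B, hB⟩ := ih (n - 1)
    refine ⟨4 * A + n * B, fun z => ?_⟩
    rw [pow_succ, mul_assoc, mul_quarticTransform,
      show z ^ m * (4 * quarticTransform (n + 3) z - n * quarticTransform (n - 1) z)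
        = 4 * (z ^ m * quarticTransform (n + 3) z)
          - n * (z ^ m * quarticTransform (n - 1) z) by ring]
    refine (abs_sub _ _).trans ?_
    rw [abs_mul 4, abs_mul (n : ℝ), Nat.abs_cast, abs_of_pos (by norm_num : (0 : ℝ) < 4)]
    gcongr
    exacts [hA z, hB z]

lemma continuous_quarticTransform (n : ℕ) : Continuous (quarticTransform n) :=
  continuous_iff_continuousAt.2 fun z => (hasDerivAt_quarticTransform n z).continuousAt

lemma integrable_pow_mul_quarticTransform (m n : ℕ) :
    Integrable (fun z => z ^ m * quarticTransform n z) := by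
  obtain ⟨A, hA⟩ := exists_bound_pow_mul_quarticTransform m n
  obtain ⟨B, hB⟩ := exists_bound_pow_mul_quarticTransform (m + 2) n
  have hcont := continuous_quarticTransform n
  refine (integrable_inv_one_add_sq.const_mul (A + B)).mono' (by fun_prop)
    (Eventually.of_forall fun z => ?_)
  rw [← div_eq_mul_inv, le_div_iff₀ (by positivity), Real.norm_eq_abs, mul_add, mul_one]
  refine add_le_add (hA z) ?_
  rw [← abs_of_nonneg (sq_nonneg z), ← abs_mul,
    show z ^ m * quarticTransform n z * z ^ 2 = z ^ (m + 2) * quarticTransform n z by ring]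
  exact hB z

lemma tendsto_pow_mul_quarticTransform (m n : ℕ) :
    Tendsto (fun z => z ^ m * quarticTransform n z) atTop (nhds 0) := by
  obtain ⟨C, hC⟩ := exists_bound_pow_mul_quarticTransform (m + 1) n
  refine squeeze_zero_norm' ?_ (tendsto_id.const_div_atTop C)
  filter_upwards [eventually_gt_atTop 0] with z hz
  rw [id, le_div_iff₀ hz, Real.norm_eq_abs]
  calc |z ^ m * quarticTransform n z| * z = |z ^ (m + 1) * quarticTransform n z| := by
        rw [pow_succ, mul_right_comm, abs_mul _ z, abs_of_pos hz]
    _ ≤ C := hC z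

lemma quarticTransform_zero_eq (z : ℝ) : quarticTransform 0 z = 2 * Real.pi * gprof z := by
  have h := integral_comp_abs (f := fun k : ℝ => Real.exp (-k ^ 4) * Real.cos (k * z))
  have heven : quarticTransform 0 z = ∫ k : ℝ, Real.exp (-|k| ^ 4) * Real.cos (|k| * z) := by
    refine integral_congr_ae (Eventually.of_forall fun k => ?_)
    rcases abs_cases k with ⟨hk, _⟩ | ⟨hk, _⟩ <;> simp [hk, Even.neg_pow (show Even 4 by decide)]
  rw [heven, h, gprof, mul_assoc 2, ← mul_assoc Real.pi, mul_one_div_cancel Real.pi_ne_zero, one_mul]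

lemma integral_pow_three_mul_quarticTransform_zero :
    ∫ z in Set.Ioi (0 : ℝ), z ^ 3 * quarticTransform 0 z = -8 * quarticTransform 0 0 := by
  have hderiv : ∀ z : ℝ, HasDerivAt (fun z => 4 * (z ^ 2 * quarticTransform 2 z
      - 2 * (z ^ 1 * quarticTransform 1 z) + 2 * (z ^ 0 * quarticTransform 0 z)))
      (z ^ 3 * quarticTransform 0 z) z := by
    intro z
    have h := (((((hasDerivAt_pow 2 z).mul (hasDerivAt_quarticTransform 2 z)).sub
      (((hasDerivAt_pow 1 z).mul (hasDerivAt_quarticTransform 1 z)).const_mul 2)).add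
      (((hasDerivAt_pow 0 z).mul (hasDerivAt_quarticTransform 0 z)).const_mul 2)).const_mul 4)
    refine h.congr_deriv ?_
    have hode := mul_quarticTransform 0 z
    norm_num at hode ⊢
    linear_combination -z ^ 2 * hode
  have htend := ((((tendsto_pow_mul_quarticTransform 2 2).sub
    ((tendsto_pow_mul_quarticTransform 1 1).const_mul 2)).add
    ((tendsto_pow_mul_quarticTransform 0 0).const_mul 2)).const_mul 4)
  rw [integral_Ioi_of_hasDerivAt_of_tendsto (hderiv 0).continuousAt.continuousWithinAt
    (fun z _ => hderiv z) (integrable_pow_mul_quarticTransform 3 0).integrableOn htend]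
  norm_num
  ring

lemma gprof_zero : gprof 0 = Real.Gamma (1 / 4) / (4 * Real.pi) := by
  have h := integral_exp_neg_rpow (p := 4) (by norm_num)
  rw [Real.Gamma_add_one (by norm_num)] at h
  norm_cast at h
  simp only [gprof, mul_zero, Real.cos_zero, mul_one]
  rw [h]
  ring

/-- `∫₀^∞ z³ g(z) dz = −8 g(0) = −2Γ(1/4)/π`. -/
theorem stmt14 :
    (∫ z in Set.Ioi (0:ℝ), z ^ 3 * gprof z) = -8 * gprof 0 ∧
    (∫ z in Set.Ioi (0:ℝ), z ^ 3 * gprof z) = -(2 * Real.Gamma (1/4) / Real.pi) := by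
  have hmoment : (∫ z in Set.Ioi (0:ℝ), z ^ 3 * gprof z) = -8 * gprof 0 := by
    have h := integral_pow_three_mul_quarticTransform_zero
    simp_rw [quarticTransform_zero_eq, mul_left_comm _ (2 * Real.pi)] at h
    rw [integral_const_mul] at h
    exact mul_left_cancel₀ (by positivity) h
  refine ⟨hmoment, hmoment.trans ?_⟩
  rw [gprof_zero]
  ring
end
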